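/- arXiv:1509.03447 — 2 statements merged into one kernel-verified Lean document; each statement's English description precedes it below -/
import Mathlib

section
/- Every planar graph is a 3-map graph, i.e., has a map in which at most three regions meet at any point. -/
open Set

noncomputable section

/-- The Euclidean plane, where graphs are drawn. -/
abbrev Plane : Type := ℝ × ℝ

/-- A drawing of a multigraph on vertex type `V` with edges indexed by `E`,
`ends e` being the (unordered) pair of endpoints of `e`.  Vertices are distinct
points, edges are simple Jordan arcs joining their endpoints, arcs avoid vertices
in their interior, and edges sharing an endpoint do not cross. -/
structure MultiDrawing (V E : Type) (ends : E → Sym2 V) where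
  pos : V → Plane
  pos_inj : Function.Injective pos
  arc : E → ℝ → Plane
  arc_cont : ∀ e, ContinuousOn (arc e) (Icc (0:ℝ) 1)
  arc_inj : ∀ e, InjOn (arc e) (Icc (0:ℝ) 1)
  arc_ends : ∀ e, ∃ u v : V, ends e = s(u, v) ∧ arc e 0 = pos u ∧ arc e 1 = pos v
  arc_avoid : ∀ e, ∀ w : V, pos w ∉ arc e '' Ioo (0:ℝ) 1
  no_incident_cross : ∀ e f, e ≠ f →
    (arc e '' Ioo (0:ℝ) 1 ∩ arc f '' Ioo (0:ℝ) 1).Nonempty →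
    ∀ x : V, ¬(x ∈ ends e ∧ x ∈ ends f)

namespace MultiDrawing

variable {V E : Type} {ends : E → Sym2 V}

/-- The interior (open part) of the arc of edge `e`. -/
def inter (D : MultiDrawing V E ends) (e : E) : Set Plane := D.arc e '' Ioo (0:ℝ) 1

/-- The crossings of edge `e`: pairs of another edge and a common interior point. -/
def crossSet (D : MultiDrawing V E ends) (e : E) : Set (E × Plane) :=
  {fp | fp.1 ≠ e ∧ fp.2 ∈ D.inter e ∩ D.inter fp.1}

/-- A planar drawing: no edge is crossed. -/
def IsPlanarD (D : MultiDrawing V E ends) : Prop := ∀ e, D.crossSet e = ∅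

/-- A 1-planar drawing: each edge is crossed at most once. -/
def IsOnePlanarD (D : MultiDrawing V E ends) : Prop := ∀ e, (D.crossSet e).Subsingleton

/-- The point set occupied by the drawing. -/
def image (D : MultiDrawing V E ends) : Set Plane :=
  range D.pos ∪ ⋃ e, D.arc e '' Icc (0:ℝ) 1

/-- A face of a drawing: a connected component of the complement of its image. -/
def IsFace (D : MultiDrawing V E ends) (F : Set Plane) : Prop :=
  ∃ p, p ∉ D.image ∧ F = connectedComponentIn D.imageᶜ p

/-- A triangulated drawing: the boundary of each face meets (segments of) exactly
three edges. -/
def IsTriangulated (D : MultiDrawing V E ends) : Prop :=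
  ∀ F : Set Plane, D.IsFace F →
    {e : E | (frontier F ∩ D.arc e '' Icc (0:ℝ) 1).Nonempty}.ncard = 3

end MultiDrawing

/-- A drawing of a simple graph: arcs indexed by its edge set. -/
abbrev SimpleGraph.Drawing {V : Type} (G : SimpleGraph V) : Type :=
  MultiDrawing V ↥G.edgeSet (fun e => (e : Sym2 V))

/-- A graph is 1-planar if it has a drawing with at most one crossing per edge. -/
def SimpleGraph.IsOnePlanar {V : Type} (G : SimpleGraph V) : Prop :=
  ∃ D : G.Drawing, D.IsOnePlanarD

/-- A graph is planar if it has a crossing-free drawing. -/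
def SimpleGraph.IsPlanarGraph {V : Type} (G : SimpleGraph V) : Prop :=
  ∃ D : G.Drawing, D.IsPlanarD

/-- Points of the sphere. -/
abbrev SpherePt : Type := ↥(Metric.sphere (0 : EuclideanSpace ℝ (Fin 3)) 1)

/-- A subset of the sphere that is homeomorphic to a closed disk. -/
def IsClosedDisk (s : Set SpherePt) : Prop :=
  Nonempty (↥s ≃ₜ ↥(Metric.closedBall (0 : Plane) 1))

/-- A map: a partition of the sphere into closed-disk regions with pairwise
disjoint interiors, some of which are labeled as countries. -/
structure SphereMap (C : Type) where
  region : C → Set SpherePt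
  country : C → Prop
  disk : ∀ c, IsClosedDisk (region c)
  int_disjoint : ∀ c d : C, c ≠ d → interior (region c) ∩ interior (region d) = ∅
  cover : ⋃ c, region c = Set.univ

/-- A `k`-map: at most `k` regions meet at any point. -/
def SphereMap.IsKMap {C : Type} (M : SphereMap C) (k : ℕ) : Prop :=
  ∀ p : SpherePt, {c : C | p ∈ M.region c}.ncard ≤ k

/-- A hole-free map: every region is a country. -/
def SphereMap.HoleFree {C : Type} (M : SphereMap C) : Prop := ∀ c, M.country c

/-- `G` is the map graph of `M`: its vertices correspond to the countries of `M`,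
with edges given by touching countries. -/
def IsMapGraphOf {V C : Type} (G : SimpleGraph V) (M : SphereMap C) : Prop :=
  ∃ φ : V ≃ {c : C // M.country c},
    ∀ u v : V, G.Adj u v ↔ u ≠ v ∧ (M.region (φ u) ∩ M.region (φ v)).Nonempty

/-- `G` is a map graph. -/
def IsMapGraph {V : Type} (G : SimpleGraph V) : Prop :=
  ∃ (C : Type) (_ : Finite C) (M : SphereMap C), IsMapGraphOf G M

/-- `G` is a `k`-map graph. -/
def IsKMapGraph {V : Type} (G : SimpleGraph V) (k : ℕ) : Prop :=
  ∃ (C : Type) (_ : Finite C) (M : SphereMap C), M.IsKMap k ∧ IsMapGraphOf G M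

/-- `G` is a hole-free `k`-map graph. -/
def IsHoleFreeKMapGraph {V : Type} (G : SimpleGraph V) (k : ℕ) : Prop :=
  ∃ (C : Type) (_ : Finite C) (M : SphereMap C),
    M.HoleFree ∧ M.IsKMap k ∧ IsMapGraphOf G M

namespace PM

/-! ### Topological tools -/

/-- Two sets are homeomorphic as subspaces. -/
def HE {X Y : Type} [TopologicalSpace X] [TopologicalSpace Y] (A : Set X) (B : Set Y) : Prop :=
  Nonempty (↥A ≃ₜ ↥B)

theorem HE.trans {X Y Z : Type} [TopologicalSpace X] [TopologicalSpace Y] [TopologicalSpace Z]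
    {A : Set X} {B : Set Y} {C : Set Z} (h : HE A B) (h' : HE B C) : HE A C := by
  obtain ⟨e⟩ := h
  obtain ⟨e'⟩ := h'
  exact ⟨e.trans e'⟩

theorem HE.symm {X Y : Type} [TopologicalSpace X] [TopologicalSpace Y]
    {A : Set X} {B : Set Y} (h : HE A B) : HE B A := by
  obtain ⟨e⟩ := h
  exact ⟨e.symm⟩

theorem HE_image {X Y : Type} [TopologicalSpace X] [TopologicalSpace Y] [T2Space Y]
    {A : Set X} (hA : IsCompact A) (f : X → Y) (hf : ContinuousOn f A) (hi : InjOn f A) :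
    HE A (f '' A) := by
  have : CompactSpace ↥A := isCompact_iff_compactSpace.1 hA
  have hc : Continuous (Equiv.Set.imageOfInjOn f A hi) := by
    apply Continuous.subtype_mk
    exact hf.domRestrict
  exact ⟨hc.homeoOfEquivCompactToT2⟩

theorem HE_ball_of_convex {K : Set Plane} (hK : IsCompact K) (hc : Convex ℝ K)
    (hi : (interior K).Nonempty) : HE K (Metric.closedBall (0 : Plane) 1) := by
  obtain ⟨h, -, h2, -⟩ :=
    exists_homeomorph_image_interior_closure_frontier_eq_unitBall hc hi hK.isBounded
  rw [hK.isClosed.closure_eq] at h2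
  rw [← h2]
  exact HE_image hK h h.continuous.continuousOn h.injective.injOn

theorem absorb {F K K' : Set Plane} (hF : IsCompact F) (hK : IsCompact K) (hK' : IsCompact K')
    (cK : Convex ℝ K) (cK' : Convex ℝ K') (hsub : K' ⊆ K) (hi : (interior K').Nonempty)
    (h1 : F ∩ K ⊆ K') (h2 : ∀ x ∈ F, x ∉ interior K) : HE (F ∪ K) (F ∪ K') := by
  classical
  obtain ⟨c, hc⟩ := hi
  let s : Set Plane := (fun x => x + c) ⁻¹' K
  let t : Set Plane := (fun x => x + c) ⁻¹' K'
  have es : s = (Homeomorph.addRight c) ⁻¹' K := rfl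
  have et : t = (Homeomorph.addRight c) ⁻¹' K' := rfl
  have hs : IsCompact s := by rw [es]; exact (Homeomorph.isCompact_preimage _).2 hK
  have ht : IsCompact t := by rw [et]; exact (Homeomorph.isCompact_preimage _).2 hK'
  have cs : Convex ℝ s := cK.translate_preimage_left c
  have ct : Convex ℝ t := cK'.translate_preimage_left c
  have hts : t ⊆ s := fun x hx => hsub hx
  have t0 : t ∈ nhds (0 : Plane) := by
    rw [et]
    apply (Homeomorph.addRight c).continuous.continuousAt.preimage_mem_nhds
    simpa using mem_interior_iff_mem_nhds.1 hc
  have s0 : s ∈ nhds (0 : Plane) := Filter.mem_of_superset t0 hts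
  have bs := NormedSpace.isVonNBounded_of_isBounded ℝ hs.isBounded
  have bt := NormedSpace.isVonNBounded_of_isBounded ℝ ht.isBounded
  let h := gaugeRescaleHomeomorph s t cs s0 bs ct t0 bt
  have him : h '' s = t := by
    have := image_gaugeRescaleHomeomorph_closure cs s0 bs ct t0 bt
    rwa [hs.isClosed.closure_eq, ht.isClosed.closure_eq] at this
  let g : Plane → Plane := fun x => h (x - c) + c
  have gcont : Continuous g := by
    have := h.continuous
    fun_prop
  have ginj : Function.Injective g := by
    intro x y hxy
    have : h (x - c) = h (y - c) := by simpa [g] using hxy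
    simpa using h.injective this
  have gK : g '' K = K' := by
    ext y
    constructor
    · rintro ⟨x, hx, rfl⟩
      have : h (x - c) ∈ h '' s := ⟨x - c, by simpa [s] using hx, rfl⟩
      rw [him] at this
      exact this
    · intro hy
      have : y - c ∈ t := by simpa [t] using hy
      rw [← him] at this
      obtain ⟨x, hx, hxy⟩ := this
      exact ⟨x + c, hx, by simp [g, hxy]⟩
  have gfix : ∀ x ∈ F ∩ K, g x = x := by
    intro x hx
    have hxs : x - c ∈ s := by simpa [s] using hx.2
    have hxt : x - c ∈ t := by simpa [t] using h1 hx
    have g1 : gauge s (x - c) = 1 := by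
      rw [gauge_eq_one_iff_mem_frontier cs s0]
      rw [frontier, hs.isClosed.closure_eq]
      refine ⟨hxs, ?_⟩
      intro hxi
      rw [es, ← Homeomorph.preimage_interior] at hxi
      exact h2 x hx.1 (by simpa using hxi)
    have g2 : gauge t (x - c) = 1 := by
      apply le_antisymm (gauge_le_one_of_mem hxt)
      rw [← g1]
      exact gauge_mono (absorbent_nhds_zero t0) hts _
    have : h (x - c) = x - c := by
      change gaugeRescale s t (x - c) = x - c
      rw [gaugeRescale, g1, g2]
      simp
    simp [g, this]
  let f : Plane → Plane := fun x => if x ∈ K then g x else x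
  have fK : ∀ x ∈ K, f x = g x := fun x hx => by simp [f, hx]
  have fF : ∀ x ∈ F, f x = x := by
    intro x hx
    by_cases hk : x ∈ K
    · rw [fK x hk, gfix x ⟨hx, hk⟩]
    · simp [f, hk]
  have fcont : ContinuousOn f (F ∪ K) := by
    apply ContinuousOn.union_of_isClosed _ _ hF.isClosed hK.isClosed
    · exact continuousOn_id.congr fF
    · exact gcont.continuousOn.congr fK
  have fmem : ∀ x ∈ K, f x ∈ K := by
    intro x hx
    rw [fK x hx]
    apply hsub
    rw [← gK]
    exact ⟨x, hx, rfl⟩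
  have finj : InjOn f (F ∪ K) := by
    intro x hx y hy hxy
    by_cases hxk : x ∈ K <;> by_cases hyk : y ∈ K
    · rw [fK x hxk, fK y hyk] at hxy
      exact ginj hxy
    · have := fmem x hxk
      rw [hxy, fF y (hy.resolve_right hyk)] at this
      exact absurd this hyk
    · have := fmem y hyk
      rw [← hxy, fF x (hx.resolve_right hxk)] at this
      exact absurd this hxk
    · simpa [f, hxk, hyk] using hxy
  have fim : f '' (F ∪ K) = F ∪ K' := by
    rw [image_union, ← gK, image_congr fK]
    congr 1
    rw [image_congr fF]
    simp
  rw [← fim]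
  exact HE_image (hF.union hK) f fcont finj

/-! ### The tiling of the plane by rectangles -/

/-- Half-width of a tile. -/
def hw (n : ℤ × ℤ) : ℝ := if Even (n.1 + n.2) then 2 else 1

/-- The closed rectangle. -/
def rect (a b c d : ℝ) : Set Plane := Icc a b ×ˢ Icc c d

theorem mem_rect {a b c d : ℝ} {x : Plane} :
    x ∈ rect a b c d ↔ (a ≤ x.1 ∧ x.1 ≤ b) ∧ (c ≤ x.2 ∧ x.2 ≤ d) := Iff.rfl

theorem mem_interior_rect {a b c d : ℝ} {x : Plane} :
    x ∈ interior (rect a b c d) ↔ (a < x.1 ∧ x.1 < b) ∧ (c < x.2 ∧ x.2 < d) := by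
  rw [rect, interior_prod_eq, interior_Icc, interior_Icc]
  rfl

theorem compact_rect (a b c d : ℝ) : IsCompact (rect a b c d) := isCompact_Icc.prod isCompact_Icc

theorem convex_rect (a b c d : ℝ) : Convex ℝ (rect a b c d) := (convex_Icc _ _).prod (convex_Icc _ _)

theorem interior_rect_nonempty {a b c d : ℝ} (h : a < b) (h' : c < d) :
    (interior (rect a b c d)).Nonempty :=
  ⟨((a + b) / 2, (c + d) / 2), mem_interior_rect.2 (by constructor <;> constructor <;> simp <;> linarith)⟩

/-- The tile with index `n`. -/
def cell (n : ℤ × ℤ) : Set Plane :=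
  rect (3 * n.1 - hw n) (3 * n.1 + hw n) (2 * n.2 - 1) (2 * n.2 + 1)

theorem hw_cases (n : ℤ × ℤ) : (hw n = 2 ∧ Even (n.1 + n.2)) ∨ (hw n = 1 ∧ ¬ Even (n.1 + n.2)) := by
  unfold hw
  split_ifs with h
  · exact Or.inl ⟨rfl, h⟩
  · exact Or.inr ⟨rfl, h⟩

theorem hw_ge (n : ℤ × ℤ) : 1 ≤ hw n := by
  rcases hw_cases n with h | h <;> rw [h.1] <;> norm_num

theorem hw_le (n : ℤ × ℤ) : hw n ≤ 2 := by
  rcases hw_cases n with h | h <;> rw [h.1] <;> norm_num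

/-- Grid adjacency. -/
def GAdj (p q : ℤ × ℤ) : Prop :=
  (p.1 = q.1 ∧ (p.2 = q.2 + 1 ∨ q.2 = p.2 + 1)) ∨ (p.2 = q.2 ∧ (p.1 = q.1 + 1 ∨ q.1 = p.1 + 1))

theorem GAdj.symm {p q : ℤ × ℤ} (h : GAdj p q) : GAdj q p := by
  unfold GAdj at *
  omega

theorem cell_compact (n : ℤ × ℤ) : IsCompact (cell n) := compact_rect _ _ _ _

/-- Two different cells in the same row have centers at distance three or more. -/
theorem row_sep {m n : ℤ × ℤ} (h2 : m.2 = n.2) (h1 : m.1 < n.1) :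
    (3 * m.1 + hw m : ℝ) ≤ 3 * n.1 - hw n := by
  have hz : (m.1 : ℝ) + 1 ≤ n.1 := by exact_mod_cast h1
  by_cases h3 : n.1 = m.1 + 1
  · rcases hw_cases m with a | a <;> rcases hw_cases n with b | b
    · have := a.2; have := b.2; grind
    · rw [a.1, b.1]; linarith
    · rw [a.1, b.1]; linarith
    · have := a.2; have := b.2; grind
  · have : m.1 + 2 ≤ n.1 := by omega
    have hz : (m.1 : ℝ) + 2 ≤ n.1 := by exact_mod_cast this
    rcases hw_cases m with a | a <;> rcases hw_cases n with b | b <;> rw [a.1, b.1] <;> linarith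

theorem cell_inter_frontier {m n : ℤ × ℤ} (h : m ≠ n) {x : Plane} (hm : x ∈ cell m) (hn : x ∈ cell n) :
    x.1 = 3 * n.1 - hw n ∨ x.1 = 3 * n.1 + hw n ∨ x.2 = 2 * n.2 - 1 ∨ x.2 = 2 * n.2 + 1 := by
  rw [cell, mem_rect] at hm hn
  obtain ⟨⟨a1, a2⟩, a3, a4⟩ := hm
  obtain ⟨⟨b1, b2⟩, b3, b4⟩ := hn
  rcases lt_trichotomy m.2 n.2 with h2 | h2 | h2
  · have : (m.2 : ℝ) + 1 ≤ n.2 := by exact_mod_cast h2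
    right; right; left; linarith
  · rcases lt_trichotomy m.1 n.1 with h1 | h1 | h1
    · have := row_sep h2 h1
      left; linarith
    · exact absurd (Prod.ext h1 h2) h
    · have := row_sep h2.symm h1
      right; left; linarith
  · have : (n.2 : ℝ) + 1 ≤ m.2 := by exact_mod_cast h2
    right; right; right; linarith

/-- Touching cells. -/
theorem touch_cases {m n : ℤ × ℤ} (h : (cell m ∩ cell n).Nonempty) (hne : m ≠ n) :
    GAdj m n ∨ ((m.1 - n.1) % 2 = 1 ∧ (m.2 - n.2) % 2 = 1 ∧ (m.1 + m.2) % 2 = 0) := by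
  obtain ⟨x, hm, hn⟩ := h
  rw [cell, mem_rect] at hm hn
  obtain ⟨⟨a1, a2⟩, a3, a4⟩ := hm
  obtain ⟨⟨b1, b2⟩, b3, b4⟩ := hn
  have c1 : (m.2 : ℝ) < n.2 + 2 := by linarith
  have c2 : (n.2 : ℝ) < m.2 + 2 := by linarith
  have c1' : m.2 < n.2 + 2 := by exact_mod_cast c1
  have c2' : n.2 < m.2 + 2 := by exact_mod_cast c2
  have c3 : (m.1 : ℝ) < n.1 + 2 := by
    linarith [hw_le m, hw_le n]
  have c4 : (n.1 : ℝ) < m.1 + 2 := by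
    linarith [hw_le m, hw_le n]
  have c3' : m.1 < n.1 + 2 := by exact_mod_cast c3
  have c4' : n.1 < m.1 + 2 := by exact_mod_cast c4
  have hne' : m.1 ≠ n.1 ∨ m.2 ≠ n.2 := by
    by_contra hh
    push Not at hh
    exact hne (Prod.ext hh.1 hh.2)
  by_cases hg : GAdj m n
  · exact Or.inl hg
  unfold GAdj at hg
  refine Or.inr ⟨by omega, by omega, ?_⟩
  rcases hw_cases m with a | a
  · exact Int.even_iff.1 a.2
  rcases hw_cases n with b | b
  · have := Int.even_iff.1 b.2
    omega
  · exfalso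
    rw [a.1] at a1 a2
    rw [b.1] at b1 b2
    have c5 : (m.1 : ℝ) < n.1 + 1 := by linarith
    have c6 : (n.1 : ℝ) < m.1 + 1 := by linarith
    have c5' : m.1 < n.1 + 1 := by exact_mod_cast c5
    have c6' : n.1 < m.1 + 1 := by exact_mod_cast c6
    omega

theorem touch_of_GAdj {m n : ℤ × ℤ} (h : GAdj m n) : (cell m ∩ cell n).Nonempty := by
  have key : ∀ m n : ℤ × ℤ, (m.1 = n.1 ∧ n.2 = m.2 + 1) → (cell m ∩ cell n).Nonempty := by
    rintro m n ⟨h1, h2⟩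
    refine ⟨(3 * m.1, 2 * m.2 + 1), ?_, ?_⟩ <;> rw [cell, mem_rect]
    · have := hw_ge m
      simp only; refine ⟨⟨?_, ?_⟩, ?_, ?_⟩ <;> linarith
    · have := hw_ge n
      rw [← h1, h2]; push_cast
      refine ⟨⟨?_, ?_⟩, ?_, ?_⟩ <;> linarith
  have key2 : ∀ m n : ℤ × ℤ, (m.2 = n.2 ∧ n.1 = m.1 + 1) → (cell m ∩ cell n).Nonempty := by
    rintro m n ⟨h1, h2⟩
    have e : hw m + hw n = 3 := by
      rcases hw_cases m with a | a <;> rcases hw_cases n with b | b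
      · have := a.2; have := b.2; grind
      · rw [a.1, b.1]; norm_num
      · rw [a.1, b.1]; norm_num
      · have := a.2; have := b.2; grind
    have := hw_ge m
    have := hw_ge n
    refine ⟨(3 * m.1 + hw m, 2 * m.2), ?_, ?_⟩ <;> rw [cell, mem_rect]
    · simp only; refine ⟨⟨?_, ?_⟩, ?_, ?_⟩ <;> linarith
    · rw [← h1, h2]; push_cast
      refine ⟨⟨?_, ?_⟩, ?_, ?_⟩ <;> linarith
  rcases h with ⟨h1, h | h⟩ | ⟨h1, h | h⟩
  · rw [inter_comm]; exact key n m ⟨h1.symm, h⟩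
  · exact key m n ⟨h1, h⟩
  · rw [inter_comm]; exact key2 n m ⟨h1.symm, h⟩
  · exact key2 m n ⟨h1, h⟩

theorem attach {J A Ar As Bs B K : Set Plane} (hJ : IsCompact J) (hAr : IsCompact Ar)
    (hAs : IsCompact As) (hBs : IsCompact Bs) (hB : IsCompact B) (hK : IsCompact K)
    (cAs : Convex ℝ As) (cBs : Convex ℝ Bs) (cB : Convex ℝ B) (cK : Convex ℝ K)
    (iAs : (interior As).Nonempty) (iBs : (interior Bs).Nonempty)
    (eA : A = Ar ∪ As) (eK : K = As ∪ Bs) (hsB : Bs ⊆ B) (hJB : ∀ x ∈ J, x ∉ B)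
    (hAB : ∀ x ∈ A, x ∈ B → x ∈ Bs) (hABi : ∀ x ∈ A, x ∉ interior B)
    (hJA : ∀ x ∈ J, x ∈ As → x ∉ interior K)
    (hArK : ∀ x ∈ Ar, x ∈ K → x ∈ As) (hArKi : ∀ x ∈ Ar, x ∉ interior K) :
    HE ((J ∪ A) ∪ B) (J ∪ A) := by
  have hA : IsCompact A := eA ▸ hAr.union hAs
  have step1 : HE ((J ∪ A) ∪ B) ((J ∪ A) ∪ Bs) := by
    apply absorb (hJ.union hA) hB hBs cB cBs hsB iBs
    · rintro x ⟨hx | hx, hb⟩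
      · exact absurd hb (hJB x hx)
      · exact hAB x hx hb
    · rintro x (hx | hx)
      · intro hb
        exact hJB x hx (interior_subset hb)
      · exact hABi x hx
  have step2 : HE ((J ∪ Ar) ∪ K) ((J ∪ Ar) ∪ As) := by
    apply absorb (hJ.union hAr) hK hAs cK cAs (eK ▸ subset_union_left) iAs
    · rintro x ⟨hx | hx, hb⟩
      · rw [eK] at hb
        exact hb.resolve_right fun h => hJB x hx (hsB h)
      · exact hArK x hx hb
    · rintro x (hx | hx)
      · intro hb
        have hb' : x ∈ K := interior_subset hb
        rw [eK] at hb'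
        exact hJA x hx (hb'.resolve_right fun h => hJB x hx (hsB h)) hb
      · exact hArKi x hx
  have e1 : (J ∪ Ar) ∪ K = (J ∪ A) ∪ Bs := by
    rw [eA, eK]; ext x; simp only [mem_union]; tauto
  have e2 : (J ∪ Ar) ∪ As = J ∪ A := by
    rw [eA]; ext x; simp only [mem_union]; tauto
  rw [e1, e2] at step2
  exact step1.trans step2
end PM


namespace PM

theorem attach_up {J : Set Plane} (hJ : IsCompact J) {c a b y0 y1 y2 : ℝ} (ha : 1 ≤ a) (hb : 1 ≤ b)
    (hab : a = 1 ∨ b = 1) (h01 : y0 < y1) (h12 : y1 < y2)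
    (hJB : ∀ x ∈ J, x ∉ rect (c - b) (c + b) y1 y2)
    (hJA : ∀ x ∈ J, x ∈ rect (c - a) (c + a) y0 y1 →
      x.1 = c - a ∨ x.1 = c + a ∨ x.2 = y0 ∨ x.2 = y1) :
    HE ((J ∪ rect (c - a) (c + a) y0 y1) ∪ rect (c - b) (c + b) y1 y2)
      (J ∪ rect (c - a) (c + a) y0 y1) := by
  apply attach (Ar := rect (c - a) (c - 1) y0 y1 ∪ rect (c + 1) (c + a) y0 y1)
    (As := rect (c - 1) (c + 1) y0 y1) (Bs := rect (c - 1) (c + 1) y1 y2)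
    (K := rect (c - 1) (c + 1) y0 y2) hJ ((compact_rect _ _ _ _).union (compact_rect _ _ _ _))
    (compact_rect _ _ _ _) (compact_rect _ _ _ _) (compact_rect _ _ _ _) (compact_rect _ _ _ _)
    (convex_rect _ _ _ _) (convex_rect _ _ _ _) (convex_rect _ _ _ _) (convex_rect _ _ _ _)
    (interior_rect_nonempty (by linarith) (by linarith))
    (interior_rect_nonempty (by linarith) (by linarith))
  · ext x
    simp only [mem_union, mem_rect]
    grind
  · ext x
    simp only [mem_union, mem_rect]
    grind
  · intro x
    simp only [mem_rect]
    grind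
  · exact hJB
  · intro x
    simp only [mem_rect]
    grind
  · intro x
    simp only [mem_rect, mem_interior_rect]
    grind
  · intro x hx hx' hi
    have h1 := hJB x hx
    have h2 := hJA x hx
    rw [mem_rect] at h1 h2 hx'
    rw [mem_interior_rect] at hi
    grind
  · intro x
    simp only [mem_union, mem_rect]
    grind
  · intro x
    simp only [mem_union, mem_rect, mem_interior_rect]
    grind

theorem attach_down {J : Set Plane} (hJ : IsCompact J) {c a b y0 y1 y2 : ℝ} (ha : 1 ≤ a) (hb : 1 ≤ b)
    (hab : a = 1 ∨ b = 1) (h01 : y0 < y1) (h12 : y1 < y2)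
    (hJB : ∀ x ∈ J, x ∉ rect (c - b) (c + b) y0 y1)
    (hJA : ∀ x ∈ J, x ∈ rect (c - a) (c + a) y1 y2 →
      x.1 = c - a ∨ x.1 = c + a ∨ x.2 = y1 ∨ x.2 = y2) :
    HE ((J ∪ rect (c - a) (c + a) y1 y2) ∪ rect (c - b) (c + b) y0 y1)
      (J ∪ rect (c - a) (c + a) y1 y2) := by
  apply attach (Ar := rect (c - a) (c - 1) y1 y2 ∪ rect (c + 1) (c + a) y1 y2)
    (As := rect (c - 1) (c + 1) y1 y2) (Bs := rect (c - 1) (c + 1) y0 y1)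
    (K := rect (c - 1) (c + 1) y0 y2) hJ ((compact_rect _ _ _ _).union (compact_rect _ _ _ _))
    (compact_rect _ _ _ _) (compact_rect _ _ _ _) (compact_rect _ _ _ _) (compact_rect _ _ _ _)
    (convex_rect _ _ _ _) (convex_rect _ _ _ _) (convex_rect _ _ _ _) (convex_rect _ _ _ _)
    (interior_rect_nonempty (by linarith) (by linarith))
    (interior_rect_nonempty (by linarith) (by linarith))
  · ext x
    simp only [mem_union, mem_rect]
    grind
  · ext x
    simp only [mem_union, mem_rect]
    grind
  · intro x
    simp only [mem_rect]
    grind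
  · exact hJB
  · intro x
    simp only [mem_rect]
    grind
  · intro x
    simp only [mem_rect, mem_interior_rect]
    grind
  · intro x hx hx' hi
    have h1 := hJB x hx
    have h2 := hJA x hx
    rw [mem_rect] at h1 h2 hx'
    rw [mem_interior_rect] at hi
    grind
  · intro x
    simp only [mem_union, mem_rect]
    grind
  · intro x
    simp only [mem_union, mem_rect, mem_interior_rect]
    grind

theorem attach_side {J : Set Plane} (hJ : IsCompact J) {a0 a1 b0 b1 c d : ℝ} (hcd : c < d)
    (ha : a0 < a1) (hb : b0 < b1) (hab : a1 = b0 ∨ b1 = a0)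
    (hJB : ∀ x ∈ J, x ∉ rect b0 b1 c d)
    (hJA : ∀ x ∈ J, x ∈ rect a0 a1 c d →
      x.1 = a0 ∨ x.1 = a1 ∨ x.2 = c ∨ x.2 = d) :
    HE ((J ∪ rect a0 a1 c d) ∪ rect b0 b1 c d) (J ∪ rect a0 a1 c d) := by
  apply attach (Ar := ∅)
    (As := rect a0 a1 c d) (Bs := rect b0 b1 c d)
    (K := rect (min a0 b0) (max a1 b1) c d) hJ isCompact_empty
    (compact_rect _ _ _ _) (compact_rect _ _ _ _) (compact_rect _ _ _ _) (compact_rect _ _ _ _)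
    (convex_rect _ _ _ _) (convex_rect _ _ _ _) (convex_rect _ _ _ _) (convex_rect _ _ _ _)
    (interior_rect_nonempty ha hcd)
    (interior_rect_nonempty hb hcd)
  · simp
  · ext x
    simp only [mem_union, mem_rect, min_le_iff, le_max_iff]
    grind
  · exact subset_rfl
  · exact hJB
  · intro x _ h
    exact h
  · intro x
    simp only [mem_rect, mem_interior_rect]
    grind
  · intro x hx hx' hi
    have h1 := hJB x hx
    have h2 := hJA x hx
    rw [mem_rect] at h1 h2 hx'
    rw [mem_interior_rect, min_lt_iff, lt_max_iff] at hi
    grind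
  · simp
  · simp

/-- Union of a finite set of cells. -/
def reg (I : Finset (ℤ × ℤ)) : Set Plane := ⋃ n ∈ I, cell n

theorem mem_reg {I : Finset (ℤ × ℤ)} {x : Plane} : x ∈ reg I ↔ ∃ n ∈ I, x ∈ cell n := by
  simp [reg]

theorem reg_compact (I : Finset (ℤ × ℤ)) : IsCompact (reg I) :=
  I.isCompact_biUnion fun n _ => cell_compact n

theorem hw_adj {m n : ℤ × ℤ} (h : GAdj m n) : hw m + hw n = 3 ∧ (hw m = 1 ∨ hw n = 1) := by
  unfold GAdj at h
  rcases hw_cases m with a | a <;> rcases hw_cases n with b | b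
  · have := a.2; have := b.2; grind
  · rw [a.1, b.1]; norm_num
  · rw [a.1, b.1]; norm_num
  · have := a.2; have := b.2; grind

theorem attach_cell {I : Finset (ℤ × ℤ)} {n n' : ℤ × ℤ} (h' : n' ∈ I)
    (hadj : GAdj n n') (hd : ∀ k ∈ I, k ≠ n' → ¬ (cell k ∩ cell n).Nonempty) :
    HE (reg (insert n I)) (reg I) := by
  classical
  have e1 : reg I = reg (I.erase n') ∪ cell n' := by
    ext x
    simp only [mem_union, mem_reg, Finset.mem_erase]
    constructor
    · rintro ⟨k, hk, hx⟩
      by_cases hkn : k = n'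
      · subst hkn; exact Or.inr hx
      · exact Or.inl ⟨k, ⟨hkn, hk⟩, hx⟩
    · rintro (⟨k, ⟨-, hk⟩, hx⟩ | hx)
      · exact ⟨k, hk, hx⟩
      · exact ⟨n', h', hx⟩
  have e2 : reg (insert n I) = (reg (I.erase n') ∪ cell n') ∪ cell n := by
    rw [← e1]
    ext x
    simp only [mem_union, mem_reg, Finset.mem_insert]
    constructor
    · rintro ⟨k, rfl | hk, hx⟩
      · exact Or.inr hx
      · exact Or.inl ⟨k, hk, hx⟩
    · rintro (⟨k, hk, hx⟩ | hx)
      · exact ⟨k, Or.inr hk, hx⟩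
      · exact ⟨n, Or.inl rfl, hx⟩
  rw [e2, e1]
  have hJ := reg_compact (I.erase n')
  have hJB : ∀ x ∈ reg (I.erase n'), x ∉ cell n := by
    intro x hx hxn
    obtain ⟨k, hk, hxk⟩ := mem_reg.1 hx
    rw [Finset.mem_erase] at hk
    exact hd k hk.2 hk.1 ⟨x, hxk, hxn⟩
  have hJA : ∀ x ∈ reg (I.erase n'), x ∈ cell n' →
      x.1 = 3 * n'.1 - hw n' ∨ x.1 = 3 * n'.1 + hw n' ∨ x.2 = 2 * n'.2 - 1 ∨ x.2 = 2 * n'.2 + 1 := by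
    intro x hx hxn
    obtain ⟨k, hk, hxk⟩ := mem_reg.1 hx
    rw [Finset.mem_erase] at hk
    exact cell_inter_frontier hk.1 hxk hxn
  have hs := hw_adj hadj
  have g1 := hw_ge n
  have g2 := hw_ge n'
  unfold cell at *
  rcases hadj with ⟨h1, h | h⟩ | ⟨h1, h | h⟩
  · -- n above n'
    have er : (2 * (n.2 : ℝ) - 1) = 2 * n'.2 + 1 := by rw [h]; push_cast; ring
    rw [h1, er] at hJB ⊢
    exact attach_up hJ g2 g1 hs.2.symm (by linarith) (by linarith) hJB hJA
  · have er : (2 * (n.2 : ℝ) + 1) = 2 * n'.2 - 1 := by rw [h]; push_cast; ring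
    rw [h1, er] at hJB ⊢
    exact attach_down hJ g2 g1 hs.2.symm (by linarith) (by linarith) hJB hJA
  · have er : (n.1 : ℝ) = n'.1 + 1 := by rw [h]; push_cast; ring
    rw [h1] at hJB ⊢
    exact attach_side hJ (by linarith) (by linarith) (by linarith) (Or.inl (by linarith)) hJB hJA
  · have er : (n'.1 : ℝ) = n.1 + 1 := by rw [h]; push_cast; ring
    rw [h1] at hJB ⊢
    exact attach_side hJ (by linarith) (by linarith) (by linarith) (Or.inr (by linarith)) hJB hJA

/-- Tree-like sets of cells. -/
inductive Tr : Finset (ℤ × ℤ) → Prop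
  | one (n : ℤ × ℤ) : Tr {n}
  | add (I : Finset (ℤ × ℤ)) (n n' : ℤ × ℤ) (hI : Tr I) (h' : n' ∈ I) (hadj : GAdj n n')
      (hd : ∀ k ∈ I, k ≠ n' → ¬ (cell k ∩ cell n).Nonempty) : Tr (insert n I)

theorem cell_interior (n : ℤ × ℤ) : (interior (cell n)).Nonempty :=
  interior_rect_nonempty (by linarith [hw_ge n]) (by linarith)

theorem Tr.disk {I : Finset (ℤ × ℤ)} (h : Tr I) : HE (reg I) (Metric.closedBall (0 : Plane) 1) := by
  induction h with
  | one n =>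
    have : reg {n} = cell n := by simp [reg]
    rw [this]
    exact HE_ball_of_convex (cell_compact n) (convex_rect _ _ _ _) (cell_interior n)
  | add I n n' hI h' hadj hd ih => exact (attach_cell h' hadj hd).trans ih
end PM


namespace PM

/-- Connectivity of a set of grid points, expressed by cuts. -/
def CutConn (S : Set (ℤ × ℤ)) : Prop :=
  ∀ A ⊆ S, A.Nonempty → A ≠ S → ∃ p ∈ A, ∃ q ∈ S, q ∉ A ∧ GAdj p q

theorem sum_unique {p q a b : ℤ × ℤ} (h : GAdj p q) (h' : GAdj a b) (e : p + q = a + b) :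
    (a = p ∧ b = q) ∨ (a = q ∧ b = p) := by
  simp only [Prod.ext_iff, Prod.fst_add, Prod.snd_add] at e ⊢
  unfold GAdj at h h'
  omega

theorem adj_sum_left {p q : ℤ × ℤ} (h : GAdj p q) : GAdj (p + q) (p + p) := by
  unfold GAdj at *
  simp only [Prod.fst_add, Prod.snd_add]
  omega

theorem adj_sum_right {p q : ℤ × ℤ} (h : GAdj p q) : GAdj (p + q) (q + q) := by
  rw [add_comm]
  exact adj_sum_left h.symm

theorem touch_double_sum {a p q : ℤ × ℤ} (h : GAdj p q)
    (ht : (cell (a + a) ∩ cell (p + q)).Nonempty) : a = p ∨ a = q := by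
  have hne : a + a ≠ p + q := by
    intro e
    simp only [Prod.ext_iff, Prod.fst_add, Prod.snd_add] at e
    unfold GAdj at h
    omega
  have := touch_cases ht hne
  unfold GAdj at *
  simp only [Prod.ext_iff, Prod.fst_add, Prod.snd_add] at *
  omega

theorem touch_sum_sum {a b p q : ℤ × ℤ} (h : GAdj p q) (h' : GAdj a b)
    (ht : (cell (a + b) ∩ cell (p + q)).Nonempty) : a + b = p + q := by
  by_contra hne
  have := touch_cases ht hne
  unfold GAdj at *
  simp only [Prod.fst_add, Prod.snd_add] at *
  omega

theorem touch_double_double {a p : ℤ × ℤ}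
    (ht : (cell (a + a) ∩ cell (p + p)).Nonempty) : a = p := by
  by_contra hne
  have hne' : a + a ≠ p + p := by
    intro e
    apply hne
    simp only [Prod.ext_iff, Prod.fst_add, Prod.snd_add] at e ⊢
    omega
  have := touch_cases ht hne'
  unfold GAdj at *
  simp only [Prod.fst_add, Prod.snd_add] at *
  omega

/-- The cells of `I` represent points and edges of `T`. -/
def Rep (T I : Finset (ℤ × ℤ)) : Prop :=
  (∀ n ∈ I, (∃ p ∈ T, n = p + p) ∨ ∃ p ∈ T, ∃ q ∈ T, GAdj p q ∧ n = p + q) ∧ ∀ p ∈ T, p + p ∈ I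

theorem grow_tree {S : Finset (ℤ × ℤ)} (hS : CutConn (S : Set (ℤ × ℤ))) (hne : S.Nonempty) (k : ℕ) :
    k + 1 ≤ S.card → ∃ T ⊆ S, T.card = k + 1 ∧ ∃ I, Tr I ∧ Rep T I := by
  classical
  induction k with
  | zero =>
    intro _
    obtain ⟨p, hp⟩ := hne
    refine ⟨{p}, by simpa using hp, by simp, {p + p}, Tr.one _, ?_, ?_⟩
    · intro n hn
      left
      exact ⟨p, by simp, by simpa using hn⟩
    · intro q hq
      rw [Finset.mem_singleton] at hq
      simp [hq]
  | succ k ih =>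
    intro hk
    obtain ⟨T, hTS, hcard, I, hI, hR1, hR2⟩ := ih (by omega)
    have hTne : (T : Set (ℤ × ℤ)).Nonempty := by
      rw [Finset.coe_nonempty, ← Finset.card_pos]
      omega
    have hTne' : (T : Set (ℤ × ℤ)) ≠ S := by
      intro h
      have : T = S := by exact_mod_cast h
      rw [this] at hcard
      omega
    obtain ⟨p, hp, q, hq, hqT, hpq⟩ := hS T (by exact_mod_cast hTS) hTne hTne'
    have hp : p ∈ T := hp
    have hq : q ∈ S := hq
    have hqT : q ∉ T := hqT
    refine ⟨insert q T, ?_, ?_, insert (q + q) (insert (p + q) I), ?_, ?_, ?_⟩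
    · intro x hx
      rcases Finset.mem_insert.1 hx with rfl | hx
      · exact hq
      · exact hTS hx
    · rw [Finset.card_insert_of_notMem hqT, hcard]
    · apply Tr.add _ (q + q) (p + q) _ (Finset.mem_insert_self _ _) (adj_sum_right hpq).symm
      · intro n hn hne ht
        rcases Finset.mem_insert.1 hn with rfl | hn
        · exact hne rfl
        rcases hR1 n hn with ⟨a, ha, rfl⟩ | ⟨a, ha, b, hb, hab, rfl⟩
        · rw [touch_double_double ht] at ha
          exact hqT ha
        · rw [inter_comm] at ht
          rcases touch_double_sum hab ht with rfl | rfl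
          · exact hqT ha
          · exact hqT hb
      · apply Tr.add _ (p + q) (p + p) hI (hR2 p hp) (adj_sum_left hpq)
        intro n hn hne ht
        rcases hR1 n hn with ⟨a, ha, rfl⟩ | ⟨a, ha, b, hb, hab, rfl⟩
        · rcases touch_double_sum hpq ht with rfl | rfl
          · exact hne rfl
          · exact hqT ha
        · have := touch_sum_sum hpq hab ht
          rcases sum_unique hab hpq this with ⟨rfl, rfl⟩ | ⟨rfl, rfl⟩
          · exact hqT hb
          · exact hqT ha
    · intro n hn
      rcases Finset.mem_insert.1 hn with rfl | hn
      · exact Or.inl ⟨q, Finset.mem_insert_self _ _, rfl⟩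
      rcases Finset.mem_insert.1 hn with rfl | hn
      · exact Or.inr ⟨p, Finset.mem_insert_of_mem hp, q, Finset.mem_insert_self _ _, hpq, rfl⟩
      rcases hR1 n hn with ⟨a, ha, rfl⟩ | ⟨a, ha, b, hb, hab, rfl⟩
      · exact Or.inl ⟨a, Finset.mem_insert_of_mem ha, rfl⟩
      · exact Or.inr ⟨a, Finset.mem_insert_of_mem ha, b, Finset.mem_insert_of_mem hb, hab, rfl⟩
    · intro a ha
      rcases Finset.mem_insert.1 ha with rfl | ha
      · exact Finset.mem_insert_self _ _
      · exact Finset.mem_insert_of_mem (Finset.mem_insert_of_mem (hR2 a ha))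

/-- Tree with prescribed contact cells. -/
theorem exists_tree {S : Finset (ℤ × ℤ)} (hS : CutConn (S : Set (ℤ × ℤ))) (hne : S.Nonempty)
    (Ct : Finset ((ℤ × ℤ) × (ℤ × ℤ))) (hCt : ∀ c ∈ Ct, c.1 ∈ S ∧ c.2 ∉ S ∧ GAdj c.1 c.2) :
    ∃ I, Tr I ∧ (∀ p ∈ S, p + p ∈ I) ∧ (∀ c ∈ Ct, c.1 + c.2 ∈ I) ∧
      ∀ n ∈ I, (∃ p ∈ S, n = p + p) ∨ (∃ p ∈ S, ∃ q ∈ S, GAdj p q ∧ n = p + q) ∨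
        ∃ c ∈ Ct, n = c.1 + c.2 := by
  classical
  induction Ct using Finset.induction_on with
  | empty =>
    have hc : 0 < S.card := Finset.card_pos.2 hne
    obtain ⟨T, hTS, hcard, I, hI, hR1, hR2⟩ := grow_tree hS hne (S.card - 1) (by omega)
    have : T = S := Finset.eq_of_subset_of_card_le hTS (by omega)
    subst this
    refine ⟨I, hI, hR2, by simp, ?_⟩
    intro n hn
    rcases hR1 n hn with h | h
    · exact Or.inl h
    · exact Or.inr (Or.inl h)
  | insert c Ct hc ih =>
    obtain ⟨I, hI, h1, h2, h3⟩ := ih fun d hd => hCt d (Finset.mem_insert_of_mem hd)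
    obtain ⟨hcS, hcS', hadj⟩ := hCt c (Finset.mem_insert_self _ _)
    refine ⟨insert (c.1 + c.2) I, ?_, ?_, ?_, ?_⟩
    · by_cases hin : c.1 + c.2 ∈ I
      · rwa [Finset.insert_eq_of_mem hin]
      apply Tr.add _ _ (c.1 + c.1) hI (h1 _ hcS) (adj_sum_left hadj)
      intro n hn hne ht
      rcases h3 n hn with ⟨a, ha, rfl⟩ | ⟨a, ha, b, hb, hab, rfl⟩ | ⟨d, hd, rfl⟩
      · rcases touch_double_sum hadj ht with rfl | rfl
        · exact hne rfl
        · exact hcS' ha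
      · have := touch_sum_sum hadj hab ht
        exact hin (this ▸ hn)
      · have := touch_sum_sum hadj (hCt d (Finset.mem_insert_of_mem hd)).2.2 ht
        exact hin (this ▸ hn)
    · exact fun p hp => Finset.mem_insert_of_mem (h1 p hp)
    · intro d hd
      rcases Finset.mem_insert.1 hd with rfl | hd
      · exact Finset.mem_insert_self _ _
      · exact Finset.mem_insert_of_mem (h2 d hd)
    · intro n hn
      rcases Finset.mem_insert.1 hn with rfl | hn
      · exact Or.inr (Or.inr ⟨c, Finset.mem_insert_self _ _, rfl⟩)
      rcases h3 n hn with h | h | ⟨d, hd, rfl⟩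
      · exact Or.inl h
      · exact Or.inr (Or.inl h)
      · exact Or.inr (Or.inr ⟨d, Finset.mem_insert_of_mem hd, rfl⟩)

/-- `G` is a minor of the grid. -/
def GridMinor {V : Type} (G : SimpleGraph V) : Prop :=
  ∃ W : V → Set (ℤ × ℤ), (∀ v, (W v).Finite ∧ (W v).Nonempty ∧ CutConn (W v)) ∧
    (∀ u v, u ≠ v → Disjoint (W u) (W v)) ∧
    ∀ u v, G.Adj u v → ∃ p ∈ W u, ∃ q ∈ W v, GAdj p q

theorem fine {V : Type} [Fintype V] {G : SimpleGraph V} (hG : GridMinor G) :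
    ∃ I : V → Finset (ℤ × ℤ), (∀ v, Tr (I v)) ∧ (∀ u v, u ≠ v → Disjoint (I u) (I v)) ∧
      ∀ u v, u ≠ v → (G.Adj u v ↔ (reg (I u) ∩ reg (I v)).Nonempty) := by
  classical
  obtain ⟨W', hW, hdis, hadj⟩ := hG
  let W : V → Finset (ℤ × ℤ) := fun v => (hW v).1.toFinset
  have hWm : ∀ v p, p ∈ W v ↔ p ∈ W' v := fun v p => by simp [W]
  have hd : ∀ u v p, p ∈ W u → p ∈ W v → u = v := by
    intro u v p hu hv
    by_contra hne
    rw [hWm] at hu hv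
    exact Set.disjoint_left.1 (hdis u v hne) hu hv
  have hadj' : ∀ u v, ∃ c : (ℤ × ℤ) × (ℤ × ℤ), G.Adj u v → c.1 ∈ W u ∧ c.2 ∈ W v ∧ GAdj c.1 c.2 := by
    intro u v
    by_cases h : G.Adj u v
    · obtain ⟨p, hp, q, hq, hpq⟩ := hadj u v h
      exact ⟨(p, q), fun _ => ⟨(hWm _ _).2 hp, (hWm _ _).2 hq, hpq⟩⟩
    · exact ⟨default, fun h' => absurd h' h⟩
  choose cc hcc using hadj'
  let f := Fintype.equivFin V
  let Ct : V → Finset ((ℤ × ℤ) × (ℤ × ℤ)) := fun u =>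
    (Finset.univ.filter fun v => G.Adj u v ∧ f u < f v).image (cc u)
  have hCtm : ∀ u c, c ∈ Ct u ↔ ∃ v, (G.Adj u v ∧ f u < f v) ∧ cc u v = c := by
    intro u c
    simp [Ct]
  have hex : ∀ u, ∃ I, Tr I ∧ (∀ p ∈ W u, p + p ∈ I) ∧ (∀ c ∈ Ct u, c.1 + c.2 ∈ I) ∧
      ∀ n ∈ I, (∃ p ∈ W u, n = p + p) ∨ (∃ p ∈ W u, ∃ q ∈ W u, GAdj p q ∧ n = p + q) ∨
        ∃ c ∈ Ct u, n = c.1 + c.2 := by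
    intro u
    apply exists_tree
    · have : (W u : Set (ℤ × ℤ)) = W' u := by simp [W]
      rw [this]
      exact (hW u).2.2
    · obtain ⟨p, hp⟩ := (hW u).2.1
      exact ⟨p, (hWm _ _).2 hp⟩
    · intro c hc
      obtain ⟨v, ⟨hv, -⟩, rfl⟩ := (hCtm _ _).1 hc
      obtain ⟨h1, h2, h3⟩ := hcc u v hv
      refine ⟨h1, fun h => ?_, h3⟩
      exact hv.ne (hd u v _ h h2)
  choose I hTr hI1 hI2 hI3 using hex
  -- normal form of the members
  have hI4 : ∀ u, ∀ n ∈ I u, (∃ p ∈ W u, n = p + p) ∨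
      ∃ p q, ∃ v, p ∈ W u ∧ q ∈ W v ∧ GAdj p q ∧ n = p + q ∧ (v = u ∨ (G.Adj u v ∧ f u < f v)) := by
    intro u n hn
    rcases hI3 u n hn with h | ⟨p, hp, q, hq, hpq, rfl⟩ | ⟨c, hc, rfl⟩
    · exact Or.inl h
    · exact Or.inr ⟨p, q, u, hp, hq, hpq, rfl, Or.inl rfl⟩
    · obtain ⟨v, hv, rfl⟩ := (hCtm _ _).1 hc
      obtain ⟨h1, h2, h3⟩ := hcc u v hv.1
      exact Or.inr ⟨_, _, v, h1, h2, h3, rfl, Or.inr hv⟩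
  have hdisj : ∀ u v n, n ∈ I u → n ∈ I v → u = v := by
    intro u v n hu hv
    have hne : ((cell n) ∩ cell n).Nonempty := by
      rw [inter_self]
      exact (cell_interior n).mono interior_subset
    rcases hI4 u n hu with ⟨p, hp, rfl⟩ | ⟨p, q, w, hp, hq, hpq, rfl, hw⟩
    · rcases hI4 v _ hv with ⟨a, ha, e⟩ | ⟨a, b, x, ha, hb, hab, e, hx⟩
      · rw [e] at hne
        have : p = a := by
          rw [← e] at hne
          nth_rewrite 2 [e] at hne
          exact touch_double_double hne
        subst this
        exact hd _ _ _ hp ha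
      · exfalso
        simp only [Prod.ext_iff, Prod.fst_add, Prod.snd_add] at e
        unfold GAdj at hab
        omega
    · rcases hI4 v _ hv with ⟨a, ha, e⟩ | ⟨a, b, x, ha, hb, hab, e, hx⟩
      · exfalso
        simp only [Prod.ext_iff, Prod.fst_add, Prod.snd_add] at e
        unfold GAdj at hpq
        omega
      · rcases sum_unique hpq hab e with ⟨rfl, rfl⟩ | ⟨rfl, rfl⟩
        · exact hd _ _ _ hp ha
        · have h1 := hd _ _ _ hp hb
          have h2 := hd _ _ _ hq ha
          subst h1 h2
          rcases hw with rfl | hw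
          · rfl
          · rcases hx with rfl | hx
            · rfl
            · exact absurd hw.2 (not_lt.2 hx.2.le)
  refine ⟨I, hTr, ?_, ?_⟩
  · intro u v huv
    rw [Finset.disjoint_left]
    intro n hu hv
    exact huv (hdisj u v n hu hv)
  · intro u v huv
    constructor
    · have key : ∀ u v, G.Adj u v → f u < f v → (reg (I u) ∩ reg (I v)).Nonempty := by
        intro u v h hlt
        obtain ⟨h1, h2, h3⟩ := hcc u v h
        obtain ⟨x, hx, hx'⟩ := touch_of_GAdj (adj_sum_right h3)
        exact ⟨x, mem_reg.2 ⟨_, hI2 u _ ((hCtm _ _).2 ⟨v, ⟨h, hlt⟩, rfl⟩), hx⟩,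
          mem_reg.2 ⟨_, hI1 v _ h2, hx'⟩⟩
      intro h
      rcases lt_trichotomy (f u) (f v) with hlt | heq | hlt
      · exact key u v h hlt
      · exact absurd (f.injective heq) huv
      · rw [inter_comm]
        exact key v u h.symm hlt
    · have key : ∀ u v p a b x, u ≠ v → p ∈ W u → a ∈ W v → b ∈ W x → GAdj a b →
          (x = v ∨ (G.Adj v x ∧ f v < f x)) → (cell (p + p) ∩ cell (a + b)).Nonempty → G.Adj v u := by
        intro u v p a b x huv hp ha hb hab hx ht
        rcases touch_double_sum hab ht with rfl | rfl
        · exact absurd (hd _ _ _ hp ha) huv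
        · have := hd _ _ _ hp hb
          subst this
          rcases hx with rfl | hx
          · exact absurd rfl huv
          · exact hx.1
      rintro ⟨x, hxu, hxv⟩
      obtain ⟨m, hm, hxm⟩ := mem_reg.1 hxu
      obtain ⟨n, hn, hxn⟩ := mem_reg.1 hxv
      have ht : (cell m ∩ cell n).Nonempty := ⟨x, hxm, hxn⟩
      rcases hI4 u m hm with ⟨p, hp, rfl⟩ | ⟨p, q, w, hp, hq, hpq, rfl, hw⟩
      · rcases hI4 v _ hn with ⟨a, ha, rfl⟩ | ⟨a, b, y, ha, hb, hab, rfl, hy⟩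
        · have := touch_double_double ht
          subst this
          exact absurd (hd _ _ _ hp ha) huv
        · exact (key u v p a b y huv hp ha hb hab hy ht).symm
      · rcases hI4 v _ hn with ⟨a, ha, rfl⟩ | ⟨a, b, y, ha, hb, hab, rfl, hy⟩
        · rw [inter_comm] at ht
          exact key v u a p q w huv.symm ha hp hq hpq hw ht
        · have := touch_sum_sum hab hpq ht
          rw [this] at hm
          exact absurd (hdisj u v _ hm hn) huv
end PM


namespace PM

theorem cutConn_iUnion {ι : Type*} (f : ι → Set (ℤ × ℤ)) (b : ℤ × ℤ) (hb : ∀ i, b ∈ f i)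
    (h : ∀ i, CutConn (f i)) : CutConn (⋃ i, f i) := by
  intro A hA hne hne'
  have key : ∃ i, (A ∩ f i).Nonempty ∧ A ∩ f i ≠ f i := by
    by_cases hbA : b ∈ A
    · have : ∃ x ∈ ⋃ i, f i, x ∉ A := by
        by_contra hh
        push Not at hh
        exact hne' (Subset.antisymm hA hh)
      obtain ⟨x, hx, hxA⟩ := this
      obtain ⟨i, hi⟩ := mem_iUnion.1 hx
      refine ⟨i, ⟨b, hbA, hb i⟩, fun e => hxA ?_⟩
      rw [← e] at hi
      exact hi.1
    · obtain ⟨a, ha⟩ := hne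
      obtain ⟨i, hi⟩ := mem_iUnion.1 (hA ha)
      refine ⟨i, ⟨a, ha, hi⟩, fun e => hbA ?_⟩
      have := hb i
      rw [← e] at this
      exact this.1
  obtain ⟨i, h1, h2⟩ := key
  obtain ⟨p, hp, q, hq, hqA, hpq⟩ := h i (A ∩ f i) inter_subset_right h1 h2
  exact ⟨p, hp.1, q, mem_iUnion.2 ⟨i, hq⟩, fun h => hqA ⟨h, hq⟩, hpq⟩

theorem cutConn_insert {P : Set (ℤ × ℤ)} (hP : CutConn P) {p q : ℤ × ℤ} (hp : p ∈ P)
    (hpq : GAdj p q) : CutConn (insert q P) := by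
  intro A hA hne hne'
  by_cases hq : q ∈ A
  · by_cases hpA : p ∈ A
    · by_cases he : A ∩ P = P
      · exfalso
        apply hne'
        apply Subset.antisymm hA
        rintro x (rfl | hx)
        · exact hq
        · rw [← he] at hx
          exact hx.1
      · obtain ⟨a, ha, b, hb, hbA, hab⟩ := hP (A ∩ P) inter_subset_right ⟨p, hpA, hp⟩ he
        exact ⟨a, ha.1, b, Or.inr hb, fun h => hbA ⟨h, hb⟩, hab⟩
    · exact ⟨q, hq, p, Or.inr hp, hpA, hpq.symm⟩
  · have hAP : A ⊆ P := fun x hx => (hA hx).resolve_left fun e => hq (e ▸ hx)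
    by_cases he : A = P
    · exact ⟨p, he ▸ hp, q, Or.inl rfl, hq, hpq⟩
    · obtain ⟨a, ha, b, hb, hbA, hab⟩ := hP A hAP hne he
      exact ⟨a, ha, b, Or.inr hb, hbA, hab⟩

theorem grow {P T Q : Set (ℤ × ℤ)} (hP : CutConn P) (hT : CutConn T) (hPT : (P ∩ T).Nonempty)
    (hQT : (Q ∩ T).Nonempty) (hPQ : Disjoint P Q) :
    ∃ P', P ⊆ P' ∧ P' ⊆ P ∪ (T \ Q) ∧ CutConn P' ∧ ∃ p ∈ P', ∃ q ∈ Q, GAdj p q := by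
  let F := {X : Set (ℤ × ℤ) // CutConn X ∧ P ⊆ X ∧ X ⊆ P ∪ (T \ Q)}
  obtain ⟨a, haP, haT⟩ := hPT
  obtain ⟨b, hbQ, hbT⟩ := hQT
  have hsub : P ⊆ ⋃ X : F, X.1 := subset_iUnion_of_subset ⟨P, hP, subset_rfl, subset_union_left⟩ subset_rfl
  have hsub' : (⋃ X : F, X.1) ⊆ P ∪ (T \ Q) := iUnion_subset fun X => X.2.2.2
  have hcc : CutConn (⋃ X : F, X.1) := cutConn_iUnion _ a (fun X => X.2.2.1 haP) fun X => X.2.1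
  have hbn : b ∉ ⋃ X : F, X.1 := by
    intro h
    rcases hsub' h with h | h
    · exact disjoint_left.1 hPQ h hbQ
    · exact h.2 hbQ
  refine ⟨⋃ X : F, X.1, hsub, hsub', hcc, ?_⟩
  obtain ⟨p, hp, q, hqT, hq, hpq⟩ := hT (T ∩ ⋃ X : F, X.1) inter_subset_left ⟨a, haT, hsub haP⟩
    (fun e => hbn (by rw [← e] at hbT; exact hbT.2))
  refine ⟨p, hp.2, q, ?_, hpq⟩
  by_contra hqQ
  apply hq
  refine ⟨hqT, mem_iUnion.2 ⟨⟨insert q (⋃ X : F, X.1), cutConn_insert hcc hp.2 hpq,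
    hsub.trans (subset_insert _ _), ?_⟩, Or.inl rfl⟩⟩
  rintro x (rfl | hx)
  · exact Or.inr ⟨hqT, hqQ⟩
  · exact hsub' hx

/-- The closed grid square. -/
def sq (ε : ℝ) (p : ℤ × ℤ) : Set Plane :=
  rect (p.1 * ε) ((p.1 + 1) * ε) (p.2 * ε) ((p.2 + 1) * ε)

/-- Grid squares meeting a set. -/
def hit (ε : ℝ) (K : Set Plane) : Set (ℤ × ℤ) := {p | (sq ε p ∩ K).Nonempty}

theorem exists_sq {ε : ℝ} (hε : 0 < ε) (x : Plane) : x ∈ sq ε (⌊x.1 / ε⌋, ⌊x.2 / ε⌋) := by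
  rw [sq, mem_rect]
  simp only
  refine ⟨⟨?_, ?_⟩, ?_, ?_⟩
  · rw [← le_div_iff₀ hε]; exact Int.floor_le _
  · rw [← div_le_iff₀ hε]; exact (Int.lt_floor_add_one _).le
  · rw [← le_div_iff₀ hε]; exact Int.floor_le _
  · rw [← div_le_iff₀ hε]; exact (Int.lt_floor_add_one _).le

theorem hit_nonempty {ε : ℝ} (hε : 0 < ε) {K : Set Plane} (h : K.Nonempty) : (hit ε K).Nonempty := by
  obtain ⟨x, hx⟩ := h
  exact ⟨_, x, exists_sq hε x, hx⟩

theorem hit_inter {ε : ℝ} (hε : 0 < ε) {K L : Set Plane} (h : (K ∩ L).Nonempty) :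
    (hit ε K ∩ hit ε L).Nonempty := by
  obtain ⟨x, hx, hx'⟩ := h
  exact ⟨_, ⟨x, exists_sq hε x, hx⟩, ⟨x, exists_sq hε x, hx'⟩⟩

theorem hit_finite {ε : ℝ} (hε : 0 < ε) {K : Set Plane} (hK : IsCompact K) : (hit ε K).Finite := by
  obtain ⟨M, hM⟩ := hK.isBounded.exists_norm_le
  have key : ∀ (y : ℝ) (k : ℤ), |y| ≤ M → k * ε ≤ y → y ≤ (k + 1) * ε →
      k ∈ Icc (⌊-M / ε⌋ - 1) ⌈M / ε⌉ := by
    intro y k hy h1 h2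
    rw [abs_le] at hy
    constructor
    · have : (-M / ε) ≤ k + 1 := by
        rw [div_le_iff₀ hε]; linarith
      have h3 : (⌊-M / ε⌋ : ℝ) ≤ k + 1 := (Int.floor_le _).trans this
      have h4 : ⌊-M / ε⌋ ≤ k + 1 := by exact_mod_cast h3
      linarith
    · have : (k : ℝ) ≤ M / ε := by
        rw [le_div_iff₀ hε]; linarith
      have h3 : (k : ℝ) ≤ ⌈M / ε⌉ := this.trans (Int.le_ceil _)
      exact_mod_cast h3
  apply ((finite_Icc (⌊-M / ε⌋ - 1) ⌈M / ε⌉).prod (finite_Icc (⌊-M / ε⌋ - 1) ⌈M / ε⌉)).subset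
  rintro p ⟨x, hx, hxK⟩
  have := hM x hxK
  have h1 : |x.1| ≤ M := (norm_fst_le x).trans this
  have h2 : |x.2| ≤ M := (norm_snd_le x).trans this
  rw [sq, mem_rect] at hx
  exact ⟨key _ _ h1 hx.1.1 hx.1.2, key _ _ h2 hx.2.1 hx.2.2⟩

theorem hit_disjoint {ε : ℝ} {K L : Set Plane} (h : ∀ x ∈ K, ∀ y ∈ L, ε < dist x y) :
    Disjoint (hit ε K) (hit ε L) := by
  rw [disjoint_left]
  rintro p ⟨x, hx, hxK⟩ ⟨y, hy, hyL⟩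
  have := h x hxK y hyL
  rw [sq, mem_rect] at hx hy
  rw [Prod.dist_eq, lt_max_iff, Real.dist_eq, Real.dist_eq, lt_abs, lt_abs] at this
  rcases this with (h | h) | (h | h) <;> linarith

theorem hit_cutConn {ε : ℝ} (hε : 0 < ε) {K : Set Plane} (hK : IsCompact K) (hc : IsPreconnected K) :
    CutConn (hit ε K) := by
  intro A hA hne hne'
  have hfin := hit_finite hε hK
  have hcl : ∀ B ⊆ hit ε K, IsClosed (⋃ p ∈ B, sq ε p) := fun B hB =>
    (hfin.subset hB).isClosed_biUnion fun p _ => (compact_rect _ _ _ _).isClosed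
  obtain ⟨b, hb, hbA⟩ : ∃ b ∈ hit ε K, b ∉ A := by
    by_contra hh
    push Not at hh
    exact hne' (Subset.antisymm hA hh)
  obtain ⟨a, ha⟩ := hne
  obtain ⟨x, hxK, hx1, hx2⟩ := isPreconnected_closed_iff.1 hc (⋃ p ∈ A, sq ε p)
    (⋃ p ∈ hit ε K \ A, sq ε p) (hcl _ hA) (hcl _ sdiff_subset)
    (by
      intro x hx
      have hs := exists_sq hε x
      by_cases h : ((⌊x.1 / ε⌋, ⌊x.2 / ε⌋) : ℤ × ℤ) ∈ A
      · exact Or.inl (mem_biUnion h hs)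
      · exact Or.inr (mem_biUnion (show _ ∈ hit ε K \ A from ⟨⟨x, hs, hx⟩, h⟩) hs))
    (by
      obtain ⟨x, hx, hxK⟩ := hA ha
      exact ⟨x, hxK, mem_biUnion ha hx⟩)
    (by
      obtain ⟨x, hx, hxK⟩ := hb
      exact ⟨x, hxK, mem_biUnion (show b ∈ hit ε K \ A from ⟨⟨x, hx, hxK⟩, hbA⟩) hx⟩)
  simp only [mem_iUnion, exists_prop] at hx1 hx2
  obtain ⟨p, hpA, hp⟩ := hx1
  obtain ⟨q, ⟨hqK, hqA⟩, hq⟩ := hx2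
  rw [sq, mem_rect] at hp hq
  obtain ⟨⟨p1, p2⟩, p3, p4⟩ := hp
  obtain ⟨⟨q1, q2⟩, q3, q4⟩ := hq
  have le_of : ∀ {k l : ℤ} {y : ℝ}, k * ε ≤ y → y ≤ (l + 1) * ε → k ≤ l + 1 := by
    intro k l y h1 h2
    have : (k : ℝ) ≤ l + 1 := le_of_mul_le_mul_right (h1.trans h2) hε
    exact_mod_cast this
  have a1 := le_of p1 q2
  have a2 := le_of q1 p2
  have a3 := le_of p3 q4
  have a4 := le_of q3 p4
  have hr : ((q.1, p.2) : ℤ × ℤ) ∈ hit ε K := by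
    refine ⟨x, ?_, hxK⟩
    rw [sq, mem_rect]
    exact ⟨⟨q1, q2⟩, p3, p4⟩
  by_cases hrA : ((q.1, p.2) : ℤ × ℤ) ∈ A
  · refine ⟨_, hrA, q, hqK, hqA, ?_⟩
    have hne : p.2 ≠ q.2 := by
      intro e
      rw [e] at hrA
      exact hqA hrA
    unfold GAdj
    clear hrA hqA
    grind
  · refine ⟨p, hpA, _, hr, hrA, ?_⟩
    have hne : p.1 ≠ q.1 := by
      intro e
      rw [← e] at hrA
      exact hrA hpA
    unfold GAdj
    clear hrA hqA
    grind

theorem exists_eps {ι : Type*} [Finite ι] (K : ι → Set Plane) (hK : ∀ i, IsCompact (K i)) :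
    ∃ ε : ℝ, 0 < ε ∧ ∀ i j, Disjoint (K i) (K j) → ∀ x ∈ K i, ∀ y ∈ K j, ε < dist x y := by
  have h : ∀ᶠ ε : ℝ in nhdsWithin 0 (Ioi 0), ∀ i j, Disjoint (K i) (K j) →
      ∀ x ∈ K i, ∀ y ∈ K j, ε < dist x y := by
    rw [Filter.eventually_all]
    intro i
    rw [Filter.eventually_all]
    intro j
    by_cases hd : Disjoint (K i) (K j)
    · obtain ⟨r, hr, h⟩ := Metric.exists_pos_forall_lt_edist (hK i) (hK j).isClosed hd
      have : Ioo (0 : ℝ) r ∈ nhdsWithin (0 : ℝ) (Ioi 0) := Ioo_mem_nhdsGT (by exact_mod_cast hr)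
      filter_upwards [this] with ε hε _ x hx y hy
      have := h x hx y hy
      rw [edist_nndist] at this
      have h2 : r < nndist x y := by exact_mod_cast this
      have h3 : (r : ℝ) < dist x y := by rw [dist_nndist]; exact_mod_cast h2
      exact hε.2.trans h3
    · exact Filter.Eventually.of_forall fun _ h => absurd h hd
  obtain ⟨ε, h1, h2⟩ := (h.and self_mem_nhdsWithin).exists
  exact ⟨ε, h2, h1⟩
end PM


namespace PM

theorem gridMinor_of_compacts {V E : Type} [Finite V] [Finite E] (G : SimpleGraph V)
    (K : V → Set Plane) (L : E → Set Plane) (src tgt : E → V)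
    (hadj : ∀ u v, G.Adj u v → ∃ e, (src e = u ∧ tgt e = v) ∨ (src e = v ∧ tgt e = u))
    (hst : ∀ e, src e ≠ tgt e)
    (hKc : ∀ v, IsCompact (K v)) (hLc : ∀ e, IsCompact (L e))
    (hKn : ∀ v, (K v).Nonempty)
    (hKp : ∀ v, IsPreconnected (K v)) (hLp : ∀ e, IsPreconnected (L e))
    (hsrc : ∀ e, (K (src e) ∩ L e).Nonempty) (htgt : ∀ e, (K (tgt e) ∩ L e).Nonempty)
    (hKK : ∀ u v, u ≠ v → Disjoint (K u) (K v))
    (hLL : ∀ e f, e ≠ f → Disjoint (L e) (L f))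
    (hKL : ∀ v e, v ≠ src e → v ≠ tgt e → Disjoint (K v) (L e)) : GridMinor G := by
  obtain ⟨ε, hε, hsep⟩ := exists_eps (Sum.elim K L) (by rintro (v | e); exacts [hKc v, hLc e])
  have sKK : ∀ u v, u ≠ v → Disjoint (hit ε (K u)) (hit ε (K v)) := fun u v h =>
    hit_disjoint (hsep (.inl u) (.inl v) (hKK u v h))
  have sLL : ∀ u v, u ≠ v → Disjoint (hit ε (L u)) (hit ε (L v)) := fun u v h =>
    hit_disjoint (hsep (.inr u) (.inr v) (hLL u v h))
  have sKL : ∀ v e, v ≠ src e → v ≠ tgt e → Disjoint (hit ε (K v)) (hit ε (L e)) := fun u v h h' =>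
    hit_disjoint (hsep (.inl u) (.inr v) (hKL u v h h'))
  have hg := fun e => grow (hit_cutConn hε (hKc (src e)) (hKp (src e)))
    (hit_cutConn hε (hLc e) (hLp e)) (hit_inter hε (hsrc e)) (hit_inter hε (htgt e))
    (sKK _ _ (hst e))
  choose P hP1 hP2 hP3 hP4 using hg
  let f : (u : V) → Option {e // src e = u} → Set (ℤ × ℤ) := fun u i =>
    match i with
    | none => hit ε (K u)
    | some e => P e.1
  have hf : ∀ u i, hit ε (K u) ⊆ f u i := by
    rintro u (_ | ⟨e, rfl⟩)
    · exact subset_rfl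
    · exact hP1 e
  have hmem : ∀ u x, x ∈ ⋃ i, f u i → x ∈ hit ε (K u) ∨
      ∃ e, src e = u ∧ x ∈ hit ε (L e) ∧ x ∉ hit ε (K (tgt e)) := by
    intro u x hx
    obtain ⟨i, hi⟩ := mem_iUnion.1 hx
    rcases i with _ | ⟨e, rfl⟩
    · exact Or.inl hi
    · rcases hP2 e hi with h | h
      · exact Or.inl h
      · exact Or.inr ⟨e, rfl, h.1, h.2⟩
  have hKW : ∀ u, hit ε (K u) ⊆ ⋃ i, f u i := fun u => subset_iUnion (f u) none
  refine ⟨fun u => ⋃ i, f u i, ?_, ?_, ?_⟩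
  · intro v
    obtain ⟨b, hb⟩ := hit_nonempty hε (hKn v)
    refine ⟨?_, ⟨b, hKW v hb⟩, ?_⟩
    · apply ((hit_finite hε (hKc v)).union
        (finite_iUnion fun e => hit_finite hε (hLc e))).subset
      intro x hx
      rcases hmem v x hx with h | ⟨e, _, h, _⟩
      · exact Or.inl h
      · exact Or.inr (mem_iUnion.2 ⟨e, h⟩)
    · apply cutConn_iUnion _ b (fun i => hf v i hb)
      rintro (_ | ⟨e, rfl⟩)
      · exact hit_cutConn hε (hKc v) (hKp v)
      · exact hP3 e
  · intro u v huv
    rw [disjoint_left]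
    intro x hx hx'
    rcases hmem u x hx with h | ⟨e, rfl, h1, h2⟩ <;> rcases hmem v x hx' with h' | ⟨e', rfl, h1', h2'⟩
    · exact disjoint_left.1 (sKK u v huv) h h'
    · by_cases hu : u = tgt e'
      · exact h2' (hu ▸ h)
      · exact disjoint_left.1 (sKL u e' huv hu) h h1'
    · by_cases hu : v = tgt e
      · exact h2 (hu ▸ h')
      · exact disjoint_left.1 (sKL v e huv.symm hu) h' h1
    · have : e ≠ e' := fun h => huv (h ▸ rfl)
      exact disjoint_left.1 (sLL e e' this) h1 h1'
  · intro u v huv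
    obtain ⟨e, ⟨rfl, rfl⟩ | ⟨rfl, rfl⟩⟩ := hadj u v huv
    · obtain ⟨p, hp, q, hq, hpq⟩ := hP4 e
      exact ⟨p, mem_iUnion.2 ⟨some ⟨e, rfl⟩, hp⟩, q, hKW _ hq, hpq⟩
    · obtain ⟨p, hp, q, hq, hpq⟩ := hP4 e
      exact ⟨q, hKW _ hq, p, mem_iUnion.2 ⟨some ⟨e, rfl⟩, hp⟩, hpq.symm⟩

theorem gridMinor_of_planar {V : Type} [Finite V] (G : SimpleGraph V) (hG : G.IsPlanarGraph) :
    GridMinor G := by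
  classical
  obtain ⟨D, hD⟩ := hG
  have : Finite G.edgeSet := inferInstance
  choose src tgt hends h0 h1 using D.arc_ends
  have hst : ∀ e, src e ≠ tgt e := by
    intro e h
    have := e.2
    rw [hends e, SimpleGraph.mem_edgeSet] at this
    exact this.ne h
  have hcross : ∀ e f s t, s ∈ Ioo (0:ℝ) 1 → t ∈ Ioo (0:ℝ) 1 → D.arc e s = D.arc f t → e = f ∧ s = t := by
    intro e f s t hs ht h
    have hef : e = f := by
      by_contra hne
      have hx : ((f, D.arc e s) : _ × Plane) ∈ D.crossSet e :=
        ⟨fun h => hne h.symm, ⟨s, hs, rfl⟩, ⟨t, ht, h.symm⟩⟩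
      rw [hD e] at hx
      exact hx
    subst hef
    exact ⟨rfl, D.arc_inj e (Ioo_subset_Icc_self hs) (Ioo_subset_Icc_self ht) h⟩
  have havoid : ∀ e w s, s ∈ Ioo (0:ℝ) 1 → D.arc e s ≠ D.pos w := fun e w s hs h =>
    D.arc_avoid e w ⟨s, hs, h⟩
  let pc : (v : V) → Option (G.edgeSet × Bool) → Set Plane := fun v i =>
    match i with
    | none => {D.pos v}
    | some (e, false) => if src e = v then D.arc e '' Icc 0 (1/3) else {D.pos v}
    | some (e, true) => if tgt e = v then D.arc e '' Icc (2/3) 1 else {D.pos v}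
  have s1 : Icc (0:ℝ) (1/3) ⊆ Icc 0 1 := Icc_subset_Icc le_rfl (by norm_num)
  have s2 : Icc (2/3:ℝ) 1 ⊆ Icc 0 1 := Icc_subset_Icc (by norm_num) le_rfl
  have s3 : Icc (1/3:ℝ) (2/3) ⊆ Icc 0 1 := Icc_subset_Icc (by norm_num) (by norm_num)
  have hpc : ∀ v i, IsCompact (pc v i) ∧ IsPreconnected (pc v i) ∧ D.pos v ∈ pc v i := by
    rintro v (_ | ⟨e, _ | _⟩)
    · exact ⟨isCompact_singleton, isPreconnected_singleton, rfl⟩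
    · dsimp only [pc]
      split_ifs with h
      · subst h
        exact ⟨isCompact_Icc.image_of_continuousOn ((D.arc_cont e).mono s1),
          isPreconnected_Icc.image _ ((D.arc_cont e).mono s1), ⟨0, by norm_num, h0 e⟩⟩
      · exact ⟨isCompact_singleton, isPreconnected_singleton, rfl⟩
    · dsimp only [pc]
      split_ifs with h
      · subst h
        exact ⟨isCompact_Icc.image_of_continuousOn ((D.arc_cont e).mono s2),
          isPreconnected_Icc.image _ ((D.arc_cont e).mono s2), ⟨1, by norm_num, h1 e⟩⟩
      · exact ⟨isCompact_singleton, isPreconnected_singleton, rfl⟩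
  have hnf : ∀ v x, x ∈ ⋃ i, pc v i → x = D.pos v ∨ ∃ e, ∃ t ∈ Ioo (0:ℝ) 1, D.arc e t = x ∧
      ((src e = v ∧ t ≤ 1/3) ∨ (tgt e = v ∧ 2/3 ≤ t)) := by
    intro v x hx
    obtain ⟨i, hi⟩ := mem_iUnion.1 hx
    rcases i with _ | ⟨e, _ | _⟩
    · exact Or.inl hi
    · dsimp only [pc] at hi
      split_ifs at hi with h
      · obtain ⟨t, ht, rfl⟩ := hi
        rcases ht.1.eq_or_lt with h' | h'
        · left; rw [← h', h0, h]
        · right; exact ⟨e, t, ⟨h', by linarith [ht.2]⟩, rfl, Or.inl ⟨h, ht.2⟩⟩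
      · exact Or.inl hi
    · dsimp only [pc] at hi
      split_ifs at hi with h
      · obtain ⟨t, ht, rfl⟩ := hi
        rcases ht.2.eq_or_lt with h' | h'
        · left; rw [h', h1, h]
        · right; exact ⟨e, t, ⟨by linarith [ht.1], h'⟩, rfl, Or.inr ⟨h, ht.1⟩⟩
      · exact Or.inl hi
  have hL : ∀ e x, x ∈ D.arc e '' Icc (1/3:ℝ) (2/3) → ∃ t ∈ Ioo (0:ℝ) 1, D.arc e t = x ∧ 1/3 ≤ t ∧ t ≤ 2/3 := by
    rintro e _ ⟨t, ht, rfl⟩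
    exact ⟨t, ⟨by linarith [ht.1], by linarith [ht.2]⟩, rfl, ht.1, ht.2⟩
  refine gridMinor_of_compacts G (fun v => ⋃ i, pc v i) (fun e => D.arc e '' Icc (1/3) (2/3)) src tgt
    ?_ hst ?_ ?_ ?_ ?_ ?_ ?_ ?_ ?_ ?_ ?_
  · intro u v huv
    refine ⟨⟨s(u, v), huv⟩, ?_⟩
    have := hends ⟨s(u, v), huv⟩
    simp only [Sym2.eq_iff] at this
    rcases this with ⟨a, b⟩ | ⟨a, b⟩
    · exact Or.inl ⟨a.symm, b.symm⟩
    · exact Or.inr ⟨b.symm, a.symm⟩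
  · exact fun v => isCompact_iUnion fun i => (hpc v i).1
  · exact fun e => isCompact_Icc.image_of_continuousOn ((D.arc_cont e).mono s3)
  · exact fun v => ⟨D.pos v, mem_iUnion.2 ⟨none, rfl⟩⟩
  · exact fun v => isPreconnected_iUnion ⟨D.pos v, mem_iInter.2 fun i => (hpc v i).2.2⟩
      fun i => (hpc v i).2.1
  · exact fun e => isPreconnected_Icc.image _ ((D.arc_cont e).mono s3)
  · intro e
    refine ⟨D.arc e (1/3), mem_iUnion.2 ⟨some (e, false), ?_⟩, ⟨1/3, by norm_num, rfl⟩⟩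
    dsimp only [pc]
    rw [if_pos rfl]
    exact ⟨1/3, by norm_num, rfl⟩
  · intro e
    refine ⟨D.arc e (2/3), mem_iUnion.2 ⟨some (e, true), ?_⟩, ⟨2/3, by norm_num, rfl⟩⟩
    dsimp only [pc]
    rw [if_pos rfl]
    exact ⟨2/3, by norm_num, rfl⟩
  · intro u v huv
    rw [disjoint_left]
    intro x hx hx'
    rcases hnf u x hx with h | ⟨e, t, ht, rfl, h⟩ <;> rcases hnf v _ hx' with h' | ⟨f, s, hs, hh, h'⟩
    · exact huv (D.pos_inj (h.symm.trans h'))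
    · exact havoid _ _ _ hs (hh.trans h)
    · exact havoid _ _ _ ht h'
    · obtain ⟨rfl, rfl⟩ := hcross _ _ _ _ hs ht hh
      rcases h with ⟨a, b⟩ | ⟨a, b⟩ <;> rcases h' with ⟨a', b'⟩ | ⟨a', b'⟩
      · exact huv (a.symm.trans a')
      · linarith
      · linarith
      · exact huv (a.symm.trans a')
  · intro e f hef
    rw [disjoint_left]
    intro x hx hx'
    obtain ⟨t, ht, rfl, -⟩ := hL e x hx
    obtain ⟨s, hs, hh, -⟩ := hL f _ hx'
    exact hef (hcross _ _ _ _ ht hs hh.symm).1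
  · intro v e hv hv'
    rw [disjoint_left]
    intro x hx hx'
    obtain ⟨t, ht, rfl, -⟩ := hL e x hx'
    rcases hnf v _ hx with h | ⟨f, s, hs, hh, h⟩
    · exact havoid _ _ _ ht h
    · obtain ⟨rfl, rfl⟩ := hcross _ _ _ _ ht hs hh.symm
      rcases h with ⟨a, b⟩ | ⟨a, b⟩
      · exact hv a.symm
      · exact hv' a.symm
end PM


namespace PM

theorem mem_cell {n : ℤ × ℤ} {x : Plane} : x ∈ cell n ↔
    (3 * n.1 - hw n ≤ x.1 ∧ x.1 ≤ 3 * n.1 + hw n) ∧ (2 * n.2 - 1 ≤ x.2 ∧ x.2 ≤ 2 * n.2 + 1) := Iff.rfl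

theorem hw_succ (j k : ℤ) : hw (j, k) + hw (j + 1, k) = 3 := by
  rcases hw_cases (j, k) with a | a <;> rcases hw_cases (j + 1, k) with b | b <;>
    have := a.2 <;> have := b.2 <;> simp only at * <;> grind

theorem cell_cover (x : Plane) : ∃ n, x ∈ cell n := by
  have hy1 := Int.floor_le ((x.2 + 1) / 2)
  have hy2 := Int.lt_floor_add_one ((x.2 + 1) / 2)
  set k := ⌊(x.2 + 1) / 2⌋
  have hx1 := Int.floor_le (x.1 / 3)
  have hx2 := Int.lt_floor_add_one (x.1 / 3)
  set j := ⌊x.1 / 3⌋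
  have hs := hw_succ j k
  by_cases h : x.1 ≤ 3 * j + hw (j, k)
  · refine ⟨(j, k), mem_cell.2 ⟨⟨?_, h⟩, ?_, ?_⟩⟩ <;> simp only
    · linarith [hw_ge (j, k)]
    · linarith
    · linarith
  · refine ⟨(j + 1, k), mem_cell.2 ⟨⟨?_, ?_⟩, ?_, ?_⟩⟩ <;> push_cast
    · linarith
    · linarith [hw_ge (j + 1, k)]
    · linarith
    · linarith

/-- breakpoint of row `k` -/
def BP (k c : ℤ) : Prop := ∃ a, (Even (a + k) ∧ c = 3 * a + 2) ∨ (¬ Even (a + k) ∧ c = 3 * a + 1)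

theorem BP_succ {k c : ℤ} (h : BP k c) (h' : BP (k - 1) c) : False := by
  obtain ⟨a, h⟩ := h
  obtain ⟨b, h'⟩ := h'
  simp only [Int.even_iff] at h h'
  omega

theorem row_cells (x : Plane) (k : ℤ) : ∃ a b : ℤ, (a = b ∨ ∃ c : ℤ, x.1 = c ∧ BP k c) ∧
    ∀ n : ℤ × ℤ, n.2 = k → x ∈ cell n → n = (a, k) ∨ n = (b, k) := by
  by_cases h : ∃ a b : ℤ, a < b ∧ x ∈ cell (a, k) ∧ x ∈ cell (b, k)
  · obtain ⟨a, b, hab, ha, hb⟩ := h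
    have hs := row_sep (m := (a, k)) (n := (b, k)) rfl hab
    refine ⟨a, b, Or.inr ?_, ?_⟩
    · have hx : x.1 = 3 * a + hw (a, k) := le_antisymm ha.1.2 (hs.trans hb.1.1)
      rcases hw_cases (a, k) with h | h
      · exact ⟨3 * a + 2, by rw [hx, h.1]; push_cast; rfl, a, Or.inl ⟨h.2, rfl⟩⟩
      · exact ⟨3 * a + 1, by rw [hx, h.1]; push_cast; rfl, a, Or.inr ⟨h.2, rfl⟩⟩
    · rintro ⟨c, k'⟩ rfl hc
      simp only [Prod.mk.injEq, and_true] at *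
      by_contra hh
      push Not at hh
      have ha := ha.1
      have hb := hb.1
      have hc := hc.1
      have key : ∀ p q r : ℤ, p < q → q < r → (x.1 ≤ 3 * p + hw (p, k')) →
          ((3 : ℝ) * r - hw (r, k') ≤ x.1) → False := by
        intro p q r hpq hqr h1 h2
        have e1 := row_sep (m := (p, k')) (n := (q, k')) rfl hpq
        have e2 := row_sep (m := (q, k')) (n := (r, k')) rfl hqr
        have := hw_ge (q, k')
        simp only at e1 e2
        linarith
      rcases lt_or_gt_of_ne hh.1 with h1 | h1
      · exact key _ _ _ h1 hab hc.2 hb.1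
      · rcases lt_or_gt_of_ne hh.2 with h2 | h2
        · exact key _ _ _ h1 h2 ha.2 hb.1
        · exact key _ _ _ hab h2 ha.2 hc.1
  · push Not at h
    by_cases h' : ∃ a : ℤ, x ∈ cell (a, k)
    · obtain ⟨a, ha⟩ := h'
      refine ⟨a, a, Or.inl rfl, ?_⟩
      rintro ⟨c, k'⟩ rfl hc
      left
      rcases lt_trichotomy a c with h1 | h1 | h1
      · exact absurd hc (h _ _ h1 ha)
      · rw [h1]
      · exact absurd ha (h _ _ h1 hc)
    · push Not at h'
      refine ⟨0, 0, Or.inl rfl, ?_⟩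
      rintro ⟨c, k'⟩ rfl hc
      exact absurd hc (h' c)

theorem rows (x : Plane) : ∃ k : ℤ, ∀ n : ℤ × ℤ, x ∈ cell n → n.2 = k ∨ (n.2 = k - 1 ∧ x.2 = (2 * k - 1 : ℤ)) := by
  have hy1 := Int.floor_le ((x.2 + 1) / 2)
  have hy2 := Int.lt_floor_add_one ((x.2 + 1) / 2)
  set k := ⌊(x.2 + 1) / 2⌋
  refine ⟨k, fun n hn => ?_⟩
  have h := (mem_cell.1 hn).2
  have h1 : (n.2 : ℝ) < k + 1 := by linarith
  have h2 : (k : ℝ) ≤ n.2 + 1 := by linarith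
  have h1' : n.2 < k + 1 := by exact_mod_cast h1
  have h2' : k ≤ n.2 + 1 := by exact_mod_cast h2
  by_cases hk : n.2 = k
  · exact Or.inl hk
  · have : n.2 = k - 1 := by omega
    refine Or.inr ⟨this, ?_⟩
    rw [this] at h
    push_cast at h ⊢
    linarith

theorem cells3 (x : Plane) : ∃ a b c : ℤ × ℤ, ∀ n, x ∈ cell n → n ∈ ({a, b, c} : Set (ℤ × ℤ)) := by
  obtain ⟨k, hk⟩ := rows x
  obtain ⟨a, b, h, hab⟩ := row_cells x k
  obtain ⟨a', b', h', hab'⟩ := row_cells x (k - 1)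
  have : a = b ∨ a' = b' := by
    rcases h with h | ⟨c, hc, h⟩
    · exact Or.inl h
    · rcases h' with h' | ⟨c', hc', h'⟩
      · exact Or.inr h'
      · exfalso
        have : c = c' := by rw [hc] at hc'; exact_mod_cast hc'
        exact BP_succ h (this ▸ h')
  rcases this with rfl | rfl
  · refine ⟨(a, k), (a', k - 1), (b', k - 1), fun n hn => ?_⟩
    simp only [mem_insert_iff, mem_singleton_iff]
    rcases hk n hn with h1 | ⟨h1, -⟩
    · rcases hab n h1 hn with h | h <;> simp [h]
    · rcases hab' n h1 hn with h | h <;> simp [h]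
  · refine ⟨(a, k), (b, k), (a', k - 1), fun n hn => ?_⟩
    simp only [mem_insert_iff, mem_singleton_iff]
    rcases hk n hn with h1 | ⟨h1, -⟩
    · rcases hab n h1 hn with h | h <;> simp [h]
    · rcases hab' n h1 hn with h | h <;> simp [h]

theorem cells2 (x : Plane) (hx : ¬ ∃ a b : ℤ, x.1 = a ∧ x.2 = b) :
    ∃ a b : ℤ × ℤ, ∀ n, x ∈ cell n → n ∈ ({a, b} : Set (ℤ × ℤ)) := by
  obtain ⟨k, hk⟩ := rows x
  obtain ⟨a, b, h, hab⟩ := row_cells x k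
  obtain ⟨a', b', h', hab'⟩ := row_cells x (k - 1)
  by_cases hy : x.2 = (2 * k - 1 : ℤ)
  · have e1 : a = b := h.resolve_right fun ⟨c, hc, _⟩ => hx ⟨c, _, hc, hy⟩
    have e2 : a' = b' := h'.resolve_right fun ⟨c, hc, _⟩ => hx ⟨c, _, hc, hy⟩
    subst e1 e2
    refine ⟨(a, k), (a', k - 1), fun n hn => ?_⟩
    simp only [mem_insert_iff, mem_singleton_iff]
    rcases hk n hn with h1 | ⟨h1, -⟩
    · rcases hab n h1 hn with h | h <;> simp [h]
    · rcases hab' n h1 hn with h | h <;> simp [h]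
  · refine ⟨(a, k), (b, k), fun n hn => ?_⟩
    simp only [mem_insert_iff, mem_singleton_iff]
    rcases hk n hn with h1 | ⟨-, h1⟩
    · exact hab n h1 hn
    · exact absurd h1 hy

theorem int_near {lo hi : ℤ} {z : ℝ} (h1 : lo ≤ z) (h2 : z ≤ hi) :
    ∃ a : ℤ, (lo : ℝ) ≤ a ∧ (a : ℝ) ≤ hi ∧ (a : ℝ) ^ 2 ≤ z ^ 2 := by
  rcases le_total 0 z with h | h
  · refine ⟨⌊z⌋, by exact_mod_cast Int.le_floor.2 h1, (Int.floor_le z).trans h2, ?_⟩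
    have : (0 : ℝ) ≤ ⌊z⌋ := by exact_mod_cast Int.floor_nonneg.2 h
    nlinarith [Int.floor_le z]
  · refine ⟨⌈z⌉, h1.trans (Int.le_ceil z), by exact_mod_cast Int.ceil_le.2 h2, ?_⟩
    have : (⌈z⌉ : ℝ) ≤ 0 := by exact_mod_cast Int.ceil_le.2 (by simpa using h)
    nlinarith [Int.le_ceil z]

theorem cell_near {n : ℤ × ℤ} {z : Plane} (hz : z ∈ cell n) :
    ∃ a b : ℤ, ((a : ℝ), (b : ℝ)) ∈ cell n ∧ (a : ℝ) ^ 2 + (b : ℝ) ^ 2 ≤ z.1 ^ 2 + z.2 ^ 2 := by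
  obtain ⟨⟨h1, h2⟩, h3, h4⟩ := mem_cell.1 hz
  obtain ⟨w, hw'⟩ : ∃ w : ℤ, hw n = w := by
    rcases hw_cases n with h | h
    · exact ⟨2, by rw [h.1]; norm_num⟩
    · exact ⟨1, by rw [h.1]; norm_num⟩
  rw [hw'] at h1 h2
  obtain ⟨a, a1, a2, a3⟩ := int_near (lo := 3 * n.1 - w) (hi := 3 * n.1 + w) (z := z.1)
    (by push_cast; exact h1) (by push_cast; exact h2)
  obtain ⟨b, b1, b2, b3⟩ := int_near (lo := 2 * n.2 - 1) (hi := 2 * n.2 + 1) (z := z.2)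
    (by push_cast; exact h3) (by push_cast; exact h4)
  push_cast at a1 a2 b1 b2
  refine ⟨a, b, mem_cell.2 ⟨⟨?_, ?_⟩, b1, b2⟩, by linarith⟩
  · rw [hw']; exact a1
  · rw [hw']; exact a2

/-- the round disk -/
def disk (L : ℝ) : Set Plane := {x | x.1 ^ 2 + x.2 ^ 2 ≤ L ^ 2}

theorem disk_subset {L : ℝ} (hL : 0 < L) {x : Plane} (hx : x ∈ disk L) :
    (-L ≤ x.1 ∧ x.1 ≤ L) ∧ (-L ≤ x.2 ∧ x.2 ≤ L) := by
  have hx : x.1 ^ 2 + x.2 ^ 2 ≤ L ^ 2 := hx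
  exact ⟨abs_le.1 (abs_le_of_sq_le_sq (by nlinarith) hL.le),
    abs_le.1 (abs_le_of_sq_le_sq (by nlinarith) hL.le)⟩

theorem disk_closed (L : ℝ) : IsClosed (disk L) :=
  isClosed_le (by fun_prop) continuous_const

theorem disk_compact {L : ℝ} (hL : 0 < L) : IsCompact (disk L) :=
  (compact_rect (-L) L (-L) L).of_isClosed_subset (disk_closed L) fun _ hx => disk_subset hL hx

theorem disk_convex (L : ℝ) : Convex ℝ (disk L) := by
  intro x hx y hy a b ha hb hab
  have hx : x.1 ^ 2 + x.2 ^ 2 ≤ L ^ 2 := hx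
  have hy : y.1 ^ 2 + y.2 ^ 2 ≤ L ^ 2 := hy
  change (a * x.1 + b * y.1) ^ 2 + (a * x.2 + b * y.2) ^ 2 ≤ L ^ 2
  have hb' : b = 1 - a := by linarith
  subst hb'
  have e : (a * x.1 + (1 - a) * y.1) ^ 2 + (a * x.2 + (1 - a) * y.2) ^ 2 =
    a * (x.1 ^ 2 + x.2 ^ 2) + (1 - a) * (y.1 ^ 2 + y.2 ^ 2)
      - a * (1 - a) * ((x.1 - y.1) ^ 2 + (x.2 - y.2) ^ 2) := by ring
  rw [e]
  have := mul_nonneg (mul_nonneg ha hb) (add_nonneg (sq_nonneg (x.1 - y.1)) (sq_nonneg (x.2 - y.2)))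
  nlinarith

theorem odisk_open (L : ℝ) : IsOpen {x : Plane | x.1 ^ 2 + x.2 ^ 2 < L ^ 2} :=
  isOpen_lt (by fun_prop) continuous_const

theorem odisk_subset (L : ℝ) : {x : Plane | x.1 ^ 2 + x.2 ^ 2 < L ^ 2} ⊆ disk L := by
  intro x hx
  have hx : x.1 ^ 2 + x.2 ^ 2 < L ^ 2 := hx
  exact hx.le

theorem disk_interior {L : ℝ} (hL : 0 < L) : (interior (disk L)).Nonempty := by
  refine ⟨(0, 0), interior_maximal (odisk_subset L) (odisk_open L) ?_⟩
  change (0 : ℝ) ^ 2 + (0 : ℝ) ^ 2 < L ^ 2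
  nlinarith

theorem hole_interior {L : ℝ} (hni : ∀ a b : ℤ, (a : ℝ) ^ 2 + (b : ℝ) ^ 2 ≠ L ^ 2) {n : ℤ × ℤ}
    (h : (cell n ∩ disk L).Nonempty) : (interior (cell n ∩ disk L)).Nonempty := by
  obtain ⟨z, hz, hzL⟩ := h
  obtain ⟨a, b, hab, hle⟩ := cell_near hz
  have hlt : (a : ℝ) ^ 2 + (b : ℝ) ^ 2 < L ^ 2 := lt_of_le_of_ne (hle.trans hzL) (hni a b)
  have hcl : ((a : ℝ), (b : ℝ)) ∈ closure (interior (cell n)) := by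
    have hc : Convex ℝ (cell n) := convex_rect _ _ _ _
    rw [hc.closure_interior_eq_closure_of_nonempty_interior (cell_interior n)]
    exact subset_closure hab
  obtain ⟨y, hy1, hy2⟩ := mem_closure_iff.1 hcl _ (odisk_open L) hlt
  refine ⟨y, interior_maximal (s := cell n ∩ disk L) ?_ ((odisk_open L).inter isOpen_interior) ⟨hy1, hy2⟩⟩
  rintro w ⟨hw1, hw2⟩
  exact ⟨interior_subset hw2, odisk_subset L hw1⟩

theorem hole_finite {L : ℝ} (hL : 0 < L) : {n : ℤ × ℤ | (cell n ∩ disk L).Nonempty}.Finite := by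
  let M : ℤ := ⌈L⌉ + 2
  apply ((finite_Icc (-M) M).prod (finite_Icc (-M) M)).subset
  rintro n ⟨x, hx, hxL⟩
  have h1 := disk_subset hL hxL
  have h2 := mem_cell.1 hx
  have hc := Int.le_ceil L
  have hw2 := hw_le n
  have e1 : (-(3 * M) : ℝ) ≤ 3 * n.1 := by simp only [M]; push_cast; linarith
  have e2 : (3 * n.1 : ℝ) ≤ 3 * M := by simp only [M]; push_cast; linarith
  have e3 : (-(2 * M) : ℝ) ≤ 2 * n.2 := by simp only [M]; push_cast; linarith
  have e4 : (2 * n.2 : ℝ) ≤ 2 * M := by simp only [M]; push_cast; linarith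
  have f1 : -(3 * M) ≤ 3 * n.1 := by exact_mod_cast e1
  have f2 : (3 * n.1) ≤ 3 * M := by exact_mod_cast e2
  have f3 : -(2 * M) ≤ 2 * n.2 := by exact_mod_cast e3
  have f4 : (2 * n.2) ≤ 2 * M := by exact_mod_cast e4
  exact ⟨⟨by linarith, by linarith⟩, by linarith, by linarith⟩

theorem half_nonint (N : ℕ) (a b : ℤ) : (a : ℝ) ^ 2 + (b : ℝ) ^ 2 ≠ (N + 1 / 2 : ℝ) ^ 2 := by
  intro h
  have : (4 * (a ^ 2 + b ^ 2) : ℤ) = 4 * ((N : ℤ) ^ 2 + N) + 1 := by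
    have : (4 * (a ^ 2 + b ^ 2) : ℝ) = 4 * ((N : ℝ) ^ 2 + N) + 1 := by rw [h]; ring
    exact_mod_cast this
  omega

/-- A nonempty open set contains a point in at most one cell. -/
theorem generic {U : Set Plane} (hU : IsOpen U) (hne : U.Nonempty) :
    ∃ x ∈ U, ∀ m n, x ∈ cell m → x ∈ cell n → m = n := by
  obtain ⟨x, hx, hx'⟩ := (dense_irrational.prod dense_irrational).inter_open_nonempty U hU hne
  refine ⟨x, hx, fun m n hm hn => ?_⟩
  by_contra hmn
  have hi : ∀ k : ℤ, x.1 ≠ k := fun k h => hx'.1 ⟨k, by rw [h]; simp⟩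
  have hi' : ∀ k : ℤ, x.2 ≠ k := fun k h => hx'.2 ⟨k, by rw [h]; simp⟩
  rcases cell_inter_frontier hmn hm hn with h | h | h | h
  · rcases hw_cases n with e | e
    · exact hi (3 * n.1 - 2) (by rw [h, e.1]; push_cast; ring)
    · exact hi (3 * n.1 - 1) (by rw [h, e.1]; push_cast; ring)
  · rcases hw_cases n with e | e
    · exact hi (3 * n.1 + 2) (by rw [h, e.1]; push_cast; ring)
    · exact hi (3 * n.1 + 1) (by rw [h, e.1]; push_cast; ring)
  · exact hi' (2 * n.2 - 1) (by rw [h]; push_cast; ring)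
  · exact hi' (2 * n.2 + 1) (by rw [h]; push_cast; ring)

end PM


namespace PM

abbrev E3 : Type := EuclideanSpace ℝ (Fin 3)

theorem mem_sph {p : E3} : p ∈ Metric.sphere (0 : E3) 1 ↔ p 0 ^ 2 + p 1 ^ 2 + p 2 ^ 2 = 1 := by
  rw [mem_sphere_zero_iff_norm, EuclideanSpace.norm_eq, Real.sqrt_eq_one, Fin.sum_univ_three]
  simp

/-- stereographic projection from a pole determined by the sign `s`, as a raw vector -/
def stv (L s : ℝ) (x : Plane) : E3 :=
  !₂[2 * L * x.1 / (L ^ 2 + (x.1 ^ 2 + x.2 ^ 2)), 2 * L * x.2 / (L ^ 2 + (x.1 ^ 2 + x.2 ^ 2)),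
    s * ((x.1 ^ 2 + x.2 ^ 2 - L ^ 2) / (L ^ 2 + (x.1 ^ 2 + x.2 ^ 2)))]

theorem stv_pos {L : ℝ} (hL : 0 < L) (x : Plane) : 0 < L ^ 2 + (x.1 ^ 2 + x.2 ^ 2) := by positivity

theorem stv_mem {L s : ℝ} (hL : 0 < L) (hs : s ^ 2 = 1) (x : Plane) :
    stv L s x ∈ Metric.sphere (0 : E3) 1 := by
  rw [mem_sph]
  have := (stv_pos hL x).ne'
  simp only [stv, PiLp.toLp_apply, Matrix.cons_val_zero, Matrix.cons_val_one, Matrix.cons_val]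
  rw [mul_pow, hs]
  field_simp
  ring

def st (L s : ℝ) (hL : 0 < L) (hs : s ^ 2 = 1) (x : Plane) : SpherePt := ⟨stv L s x, stv_mem hL hs x⟩

variable {L s : ℝ} (hL : 0 < L) (hs : s ^ 2 = 1)

theorem st_continuous : Continuous (st L s hL hs) := by
  apply Continuous.subtype_mk
  unfold stv
  apply (PiLp.continuous_toLp 2 _).comp
  have h : ∀ x : Plane, L ^ 2 + (x.1 ^ 2 + x.2 ^ 2) ≠ 0 := fun x => (stv_pos hL x).ne'
  apply continuous_pi
  intro i
  fin_cases i
  · have := Continuous.div (f := fun x : Plane => 2 * L * x.1) (by fun_prop) (by fun_prop) h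
    exact this
  · have := Continuous.div (f := fun x : Plane => 2 * L * x.2) (by fun_prop) (by fun_prop) h
    exact this
  · have := (continuous_const (y := s)).mul
      (Continuous.div (f := fun x : Plane => x.1 ^ 2 + x.2 ^ 2 - L ^ 2) (by fun_prop) (by fun_prop) h)
    exact this

theorem st_z (x : Plane) : s * (st L s hL hs x).1 2 =
    (x.1 ^ 2 + x.2 ^ 2 - L ^ 2) / (L ^ 2 + (x.1 ^ 2 + x.2 ^ 2)) := by
  simp only [st, stv, PiLp.toLp_apply, Matrix.cons_val]
  rw [← mul_assoc, ← pow_two, hs, one_mul]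

/-- the inverse -/
def sti (L s : ℝ) (p : SpherePt) : Plane := (L * p.1 0 / (1 - s * p.1 2), L * p.1 1 / (1 - s * p.1 2))

theorem sti_st (x : Plane) : sti L s (st L s hL hs x) = x := by
  have hp := (stv_pos hL x).ne'
  have e : 1 - s * (st L s hL hs x).1 2 = 2 * L ^ 2 / (L ^ 2 + (x.1 ^ 2 + x.2 ^ 2)) := by
    rw [st_z]; field_simp; ring
  unfold sti
  rw [e]
  ext
  · simp only [st, stv, PiLp.toLp_apply, Matrix.cons_val_zero]
    field_simp
  · simp only [st, stv, PiLp.toLp_apply, Matrix.cons_val_one, Matrix.cons_val_zero]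
    field_simp

theorem st_inj : Function.Injective (st L s hL hs) :=
  Function.LeftInverse.injective (sti_st hL hs)

theorem st_surj {p : SpherePt} (hp : s * p.1 2 ≠ 1) : st L s hL hs (sti L s p) = p := by
  have hq := mem_sph.1 p.2
  have h1 : 1 - s * p.1 2 ≠ 0 := fun h => hp (by linarith)
  have hz : p.1 0 ^ 2 + p.1 1 ^ 2 = (1 - s * p.1 2) * (1 + s * p.1 2) := by
    linear_combination hq + (p.1 2) ^ 2 * hs
  have hr : (sti L s p).1 ^ 2 + (sti L s p).2 ^ 2 = L ^ 2 * (1 + s * p.1 2) / (1 - s * p.1 2) := by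
    unfold sti
    simp only
    rw [div_pow, div_pow, ← add_div, mul_pow, mul_pow, ← mul_add, hz]
    field_simp
  have hd : L ^ 2 + ((sti L s p).1 ^ 2 + (sti L s p).2 ^ 2) = 2 * L ^ 2 / (1 - s * p.1 2) := by
    rw [hr]; field_simp; ring
  apply Subtype.ext
  ext i
  simp only [st, stv]
  rw [hd]
  fin_cases i
  · simp [sti]; field_simp
  · simp [sti]; field_simp
  · simp only [hr]
    simp
    field_simp
    linear_combination (2 * p.1 2) * hs

theorem st_le (x : Plane) : s * (st L s hL hs x).1 2 ≤ 0 ↔ x ∈ disk L := by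
  have h := stv_pos hL x
  rw [st_z, div_le_iff₀ h, zero_mul, sub_nonpos]
  rfl

theorem st_eq (x : Plane) : (st L s hL hs x).1 2 = 0 ↔ x.1 ^ 2 + x.2 ^ 2 = L ^ 2 := by
  have h := (stv_pos hL x).ne'
  have hs0 : s ≠ 0 := by rintro rfl; norm_num at hs
  have := st_z hL hs x
  constructor
  · intro h0
    rw [h0, mul_zero, eq_comm, div_eq_zero_iff] at this
    linarith [this.resolve_right h]
  · intro h0
    rw [h0, sub_self, zero_div] at this
    exact (mul_eq_zero.1 this).resolve_left hs0

theorem st_image_disk : st L s hL hs '' disk L = {p | s * p.1 2 ≤ 0} := by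
  ext p
  constructor
  · rintro ⟨x, hx, rfl⟩
    exact (st_le hL hs x).2 hx
  · intro hp
    have hp : s * p.1 2 ≤ 0 := hp
    have := st_surj hL hs (p := p) (by linarith)
    refine ⟨_, ?_, this⟩
    rw [← st_le hL hs, this]
    exact hp

end PM


namespace PM

theorem count_le {ι : Type} (T : ι → Set Plane) (own : ι → Set (ℤ × ℤ))
    (hown : ∀ c x, x ∈ T c → ∃ n ∈ own c, x ∈ cell n)
    (hdisj : ∀ c d, c ≠ d → Disjoint (own c) (own d)) (x : Plane) (S : Set (ℤ × ℤ)) (hS : S.Finite)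
    (h : ∀ n, x ∈ cell n → n ∈ S) : {c | x ∈ T c}.ncard ≤ S.ncard := by
  have hc : ∀ c, ∃ n, x ∈ T c → n ∈ own c ∧ x ∈ cell n := by
    intro c
    by_cases hx : x ∈ T c
    · obtain ⟨n, h1, h2⟩ := hown c x hx
      exact ⟨n, fun _ => ⟨h1, h2⟩⟩
    · exact ⟨(0, 0), fun h => absurd h hx⟩
  choose g hg using hc
  refine ncard_le_ncard_of_injOn g (fun c hc => h _ (hg c hc).2) ?_ hS
  intro c hc d hd hcd
  by_contra hne
  have h2 := (hg d hd).1
  rw [← hcd] at h2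
  exact disjoint_left.1 (hdisj c d hne) (hg c hc).1 h2

theorem no_circle {U : Set Plane} (hU : IsOpen U) (hne : U.Nonempty) {L : ℝ} (hL : 0 < L)
    (h : ∀ x ∈ U, x.1 ^ 2 + x.2 ^ 2 = L ^ 2) : False := by
  obtain ⟨u, hu⟩ := hne
  have hc : Continuous fun t : ℝ => t • u := by fun_prop
  have h1 : ∀ᶠ t in nhds (1 : ℝ), t • u ∈ U :=
    hc.continuousAt.eventually_mem (hU.mem_nhds (by simpa using hu))
  have h2 : ∀ᶠ t in nhdsWithin (1 : ℝ) (Ioi 1), t • u ∈ U := h1.filter_mono nhdsWithin_le_nhds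
  obtain ⟨t, ht, ht1⟩ := (h2.and self_mem_nhdsWithin).exists
  have ht1 : 1 < t := ht1
  have e1 := h u hu
  have e2 : (t * u.1) ^ 2 + (t * u.2) ^ 2 = L ^ 2 := h _ ht
  have e3 : t ^ 2 * L ^ 2 = L ^ 2 := by linear_combination e2 - t ^ 2 * e1
  have h0 : 0 < L ^ 2 := by positivity
  have h3 : 1 < t ^ 2 := by nlinarith
  nlinarith

theorem sphereMap_of {ι : Type} [Finite ι] (N : ℕ) (T : ι → Set Plane) (own : ι → Set (ℤ × ℤ))
    (cty : ι → Prop)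
    (hTc : ∀ c, IsCompact (T c)) (hT : ∀ c, HE (T c) (Metric.closedBall (0 : Plane) 1))
    (hTd : ∀ c, T c ⊆ disk (N + 1 / 2))
    (hown : ∀ c x, x ∈ T c → ∃ n ∈ own c, x ∈ cell n)
    (hdisj : ∀ c d, c ≠ d → Disjoint (own c) (own d))
    (hcov : ∀ x ∈ disk (N + 1 / 2 : ℝ), ∃ c, x ∈ T c) :
    ∃ M : SphereMap (Option ι), M.IsKMap 3 ∧ ¬ M.country none ∧ (∀ c, M.country (some c) ↔ cty c) ∧
      ∀ c d, (M.region (some c) ∩ M.region (some d)).Nonempty ↔ (T c ∩ T d).Nonempty := by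
  have hL : (0 : ℝ) < N + 1 / 2 := by positivity
  have hni := half_nonint N
  set L : ℝ := N + 1 / 2
  have h1 : (1 : ℝ) ^ 2 = 1 := by norm_num
  have h2 : (-1 : ℝ) ^ 2 = 1 := by norm_num
  set F := st L 1 hL h1
  have hFc : Continuous F := st_continuous hL h1
  have hFi : Function.Injective F := st_inj hL h1
  have hFd : F '' disk L = {p | 1 * p.1 2 ≤ 0} := st_image_disk hL h1
  set Fup := st L (-1) hL h2
  have hFc' : Continuous Fup := st_continuous hL h2
  have hFi' : Function.Injective Fup := st_inj hL h2
  have hFd' : Fup '' disk L = {p | -1 * p.1 2 ≤ 0} := st_image_disk hL h2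
  have lower : ∀ p : SpherePt, p.1 2 ≤ 0 → ∃ x ∈ disk L, F x = p := by
    intro p hp
    have : p ∈ F '' disk L := by rw [hFd]; show 1 * p.1 2 ≤ 0; linarith
    exact this
  have lower' : ∀ c p, p ∈ F '' T c → p.1 2 ≤ 0 := by
    intro c p hp
    have : p ∈ F '' disk L := image_mono (hTd c) hp
    rw [hFd] at this
    have : 1 * p.1 2 ≤ 0 := this
    linarith
  have upper : ∀ p : SpherePt, p ∈ Fup '' disk L ↔ 0 ≤ p.1 2 := by
    intro p
    rw [hFd']
    constructor
    · intro h
      have : -1 * p.1 2 ≤ 0 := h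
      linarith
    · intro h
      show -1 * p.1 2 ≤ 0
      linarith
  let R : Option ι → Set SpherePt := fun o => o.elim (Fup '' disk L) fun c => F '' T c
  have pull : ∀ U : Set SpherePt, IsOpen U → U.Nonempty → (∀ p ∈ U, p.1 2 ≤ 0) →
      IsOpen (F ⁻¹' U) ∧ (F ⁻¹' U).Nonempty := by
    rintro U hU ⟨p, hp⟩ hz
    obtain ⟨x, -, hx⟩ := lower p (hz p hp)
    exact ⟨hU.preimage hFc, x, by rw [mem_preimage, hx]; exact hp⟩
  have outer : ∀ c, interior (F '' T c) ∩ interior (Fup '' disk L) = ∅ := by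
    intro c
    by_contra hne
    obtain ⟨ho, hn⟩ := pull _ (isOpen_interior.inter isOpen_interior) (nonempty_iff_ne_empty.2 hne)
      (fun p hp => lower' c p (interior_subset hp.1))
    refine no_circle ho hn hL fun x hx => ?_
    rw [← st_eq hL h1]
    exact le_antisymm (lower' c _ (interior_subset hx.1)) ((upper _).1 (interior_subset hx.2))
  refine ⟨⟨R, fun o => o.elim False cty, ?_, ?_, ?_⟩, ?_, ?_, ?_, ?_⟩
  · rintro (_ | c)
    · exact (HE_image (disk_compact hL) Fup hFc'.continuousOn hFi'.injOn).symm.trans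
        (HE_ball_of_convex (disk_compact hL) (disk_convex L) (disk_interior hL))
    · exact (HE_image (hTc c) F hFc.continuousOn hFi.injOn).symm.trans (hT c)
  · rintro (_ | c) (_ | d) hcd
    · exact absurd rfl hcd
    · rw [inter_comm]; exact outer d
    · exact outer c
    · have hcd : c ≠ d := fun h => hcd (h ▸ rfl)
      by_contra hne
      obtain ⟨ho, hn⟩ := pull _ (isOpen_interior.inter isOpen_interior) (nonempty_iff_ne_empty.2 hne)
        (fun p hp => lower' c p (interior_subset hp.1))
      obtain ⟨x, ⟨hx1, hx2⟩, hgen⟩ := generic ho hn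
      have hx1 : F x ∈ F '' T c := interior_subset hx1
      have hx2 : F x ∈ F '' T d := interior_subset hx2
      rw [hFi.mem_set_image] at hx1 hx2
      obtain ⟨m, hm, hm'⟩ := hown c x hx1
      obtain ⟨n, hn, hn'⟩ := hown d x hx2
      have := hgen m n hm' hn'
      exact disjoint_left.1 (hdisj c d hcd) hm (this ▸ hn)
  · rw [eq_univ_iff_forall]
    intro p
    rw [mem_iUnion]
    rcases le_total (p.1 2) 0 with h | h
    · obtain ⟨x, hx, rfl⟩ := lower p h
      obtain ⟨c, hc⟩ := hcov x hx
      exact ⟨some c, x, hc, rfl⟩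
    · exact ⟨none, (upper p).2 h⟩
  · intro p
    change {o | p ∈ R o}.ncard ≤ 3
    rcases lt_or_ge 0 (p.1 2) with h | h
    · have : {o | p ∈ R o} ⊆ {none} := by
        rintro (_ | c) ho
        · rfl
        · exact absurd (lower' c p ho) (not_le.2 h)
      refine (ncard_le_ncard this).trans ?_
      simp
    · obtain ⟨x, hx, rfl⟩ := lower p h
      have hsome : ∀ c, F x ∈ R (some c) → x ∈ T c := by
        intro c hc
        exact (hFi.mem_set_image).1 hc
      rcases h.lt_or_eq with h | h
      · have : {o | F x ∈ R o} ⊆ some '' {c | x ∈ T c} := by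
          rintro (_ | c) ho
          · exact absurd ((upper _).1 ho) (not_le.2 h)
          · exact ⟨c, hsome c ho, rfl⟩
        obtain ⟨a, b, c, habc⟩ := cells3 x
        have h3 := count_le T own hown hdisj x {a, b, c} (toFinite _) habc
        have h4 : ({a, b, c} : Set (ℤ × ℤ)).ncard ≤ 3 := by
          have e1 := ncard_insert_le a {b, c}
          have e2 := ncard_insert_le b {c}
          have e3 := ncard_singleton c
          omega
        have h5 := ncard_le_ncard this (toFinite _)
        have h6 := ncard_image_le (f := (some : ι → Option ι)) (toFinite {c | x ∈ T c})
        omega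
      · have : {o | F x ∈ R o} ⊆ insert none (some '' {c | x ∈ T c}) := by
          rintro (_ | c) ho
          · exact Or.inl rfl
          · exact Or.inr ⟨c, hsome c ho, rfl⟩
        have hxL := (st_eq hL h1 x).1 h
        obtain ⟨a, b, hab⟩ := cells2 x (by
          rintro ⟨a, b, ha, hb⟩
          apply hni a b
          rw [← ha, ← hb]
          exact hxL)
        have h3 := count_le T own hown hdisj x {a, b} (toFinite _) hab
        have h4 : ({a, b} : Set (ℤ × ℤ)).ncard ≤ 2 := by
          have e2 := ncard_insert_le a {b}
          have e3 := ncard_singleton b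
          omega
        have h5 := ncard_le_ncard this (toFinite _)
        have h6 := ncard_image_le (f := (some : ι → Option ι)) (toFinite {c | x ∈ T c})
        have h7 := ncard_insert_le (none : Option ι) (some '' {c | x ∈ T c})
        omega
  · exact fun h => h
  · exact fun c => Iff.rfl
  · intro c d
    change (F '' T c ∩ F '' T d).Nonempty ↔ _
    rw [← image_inter hFi, image_nonempty]

theorem main {V : Type} [Fintype V] (G : SimpleGraph V) (hG : G.IsPlanarGraph) : IsKMapGraph G 3 := by
  classical
  obtain ⟨I, hTr, hdis, hadj⟩ := fine (gridMinor_of_planar G hG)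
  have hcomp : IsCompact (⋃ v, reg (I v)) := isCompact_iUnion fun v => reg_compact _
  obtain ⟨M, hM⟩ := hcomp.isBounded.exists_norm_le
  obtain ⟨N, hN⟩ := exists_nat_ge (2 * M)
  have hL : (0 : ℝ) < N + 1 / 2 := by positivity
  have hni := half_nonint N
  have hreg : ∀ v, reg (I v) ⊆ disk (N + 1 / 2) := by
    intro v x hx
    have h := hM x (mem_iUnion.2 ⟨v, hx⟩)
    have a1 := (norm_fst_le x).trans h
    have a2 := (norm_snd_le x).trans h
    rw [Real.norm_eq_abs] at a1 a2
    have h0 : 0 ≤ M := (norm_nonneg x).trans h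
    have b1 : x.1 ^ 2 ≤ M ^ 2 := sq_le_sq.2 (by rwa [abs_of_nonneg h0])
    have b2 : x.2 ^ 2 ≤ M ^ 2 := sq_le_sq.2 (by rwa [abs_of_nonneg h0])
    change x.1 ^ 2 + x.2 ^ 2 ≤ (N + 1 / 2 : ℝ) ^ 2
    nlinarith
  let H := {n : ℤ × ℤ // (cell n ∩ disk (N + 1 / 2)).Nonempty ∧ ∀ v, n ∉ I v}
  have hHfin : Finite H := ((hole_finite hL).subset fun n hn => hn.1 :
    {n : ℤ × ℤ | (cell n ∩ disk (N + 1 / 2)).Nonempty ∧ ∀ v, n ∉ I v}.Finite)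
  obtain ⟨M, hM3, hM0, hMc, hMi⟩ := sphereMap_of (ι := V ⊕ H) N
    (Sum.elim (fun v => reg (I v)) fun n => cell n.1 ∩ disk (N + 1 / 2))
    (Sum.elim (fun v => (I v : Set (ℤ × ℤ))) fun n => {n.1})
    (fun c => c.isLeft = true)
    (by
      rintro (v | n)
      · exact reg_compact _
      · exact (cell_compact _).inter_right (disk_closed _))
    (by
      rintro (v | n)
      · exact (hTr v).disk
      · exact HE_ball_of_convex ((cell_compact _).inter_right (disk_closed _))
          ((convex_rect _ _ _ _).inter (disk_convex _)) (hole_interior hni n.2.1))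
    (by
      rintro (v | n)
      · exact hreg v
      · exact inter_subset_right)
    (by
      rintro (v | n) x hx
      · exact mem_reg.1 hx
      · exact ⟨n.1, rfl, hx.1⟩)
    (by
      rintro (u | m) (v | n) h
      · exact Finset.disjoint_coe.2 (hdis u v fun e => h (e ▸ rfl))
      · exact disjoint_singleton_right.2 (n.2.2 u)
      · exact disjoint_singleton_left.2 (m.2.2 v)
      · exact disjoint_singleton.2 fun e => h (congrArg _ (Subtype.ext e)))
    (by
      intro x hx
      obtain ⟨n, hn⟩ := cell_cover x
      by_cases h : ∃ v, n ∈ I v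
      · obtain ⟨v, hv⟩ := h
        exact ⟨.inl v, mem_reg.2 ⟨n, hv, hn⟩⟩
      · push Not at h
        exact ⟨.inr ⟨n, ⟨x, hn, hx⟩, h⟩, hn, hx⟩)
  refine ⟨Option (V ⊕ H), inferInstance, M, hM3, ?_⟩
  refine ⟨Equiv.ofBijective (fun v => ⟨some (.inl v), (hMc _).2 rfl⟩) ⟨?_, ?_⟩, ?_⟩
  · intro u v h
    simpa using h
  · rintro ⟨(_ | (v | n)), hc⟩
    · exact absurd hc hM0
    · exact ⟨v, rfl⟩
    · have := (hMc _).1 hc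
      simp at this
  · intro u v
    have := hMi (.inl u) (.inl v)
    constructor
    · intro h
      exact ⟨h.ne, this.2 ((hadj u v h.ne).1 h)⟩
    · rintro ⟨hne, h⟩
      exact (hadj u v hne).2 (this.1 h)

end PM


/-- Every planar graph is a 3-map graph: it has a map in which
at most three regions meet at any point. -/
theorem planar_is_three_map_graph {V : Type} [Fintype V] (G : SimpleGraph V)
    (hG : G.IsPlanarGraph) : IsKMapGraph G 3 := by
  exact PM.main G hG
end
end

section
/- For n = 8 and for every n ≥ 10 there exists a 1-planar graph on n vertices with exactly 4n − 8 edges. -/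
open Set

noncomputable section

/-! ### From abstract edge types to simple graphs -/

theorem finish_graph {V E : Type} [Fintype V] [Fintype E] {ends : E → Sym2 V} (n : ℕ)
    (hV : Fintype.card V = n) (hinj : Function.Injective ends)
    (hd : ∀ e, ¬ (ends e).IsDiag) (D : MultiDrawing V E ends) (hD : D.IsOnePlanarD) :
    ∃ G : SimpleGraph (Fin n), G.IsOnePlanar ∧ G.edgeSet.ncard = Fintype.card E := by
  classical
  let σ : V ≃ Fin n := Fintype.equivFinOfCardEq hV
  let f : E → Sym2 (Fin n) := fun e => Sym2.map σ (ends e)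
  have hf : Function.Injective f := (Sym2.map.injective σ.injective).comp hinj
  let G : SimpleGraph (Fin n) := SimpleGraph.fromEdgeSet (range f)
  have hdiag : ∀ e, ¬ (f e).IsDiag := by
    intro e h
    exact hd e ((Sym2.isDiag_map σ.injective).1 h)
  have hG : G.edgeSet = range f := by
    rw [SimpleGraph.edgeSet_fromEdgeSet]
    ext x
    constructor
    · rintro ⟨h, _⟩; exact h
    · rintro ⟨e, rfl⟩
      exact ⟨⟨e, rfl⟩, hdiag e⟩
  have hg : ∀ e : G.edgeSet, ∃ e0, f e0 = e := by
    intro e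
    exact hG.subset e.2
  choose g hg using hg
  have ginj : Function.Injective g := by
    intro e e' h
    apply Subtype.ext
    rw [← hg e, ← hg e', h]
  refine ⟨G, ⟨{ pos := fun v => D.pos (σ.symm v)
                pos_inj := D.pos_inj.comp σ.symm.injective
                arc := fun e => D.arc (g e)
                arc_cont := fun e => D.arc_cont _
                arc_inj := fun e => D.arc_inj _
                arc_ends := ?_
                arc_avoid := fun e w => D.arc_avoid _ _
                no_incident_cross := ?_ }, ?_⟩, ?_⟩
  · intro e
    obtain ⟨u, v, h1, h2, h3⟩ := D.arc_ends (g e)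
    refine ⟨σ u, σ v, ?_, by simpa using h2, by simpa using h3⟩
    rw [← hg e]
    simp [f, h1]
  · intro e e' hne hcr x hx
    rw [← hg e, ← hg e'] at hx
    obtain ⟨h1, h2⟩ := hx
    simp only [f, Sym2.mem_map] at h1 h2
    obtain ⟨a, ha, rfl⟩ := h1
    obtain ⟨b, hb, hab⟩ := h2
    have := σ.injective hab
    subst this
    exact D.no_incident_cross _ _ (fun h => hne (ginj h)) hcr _ ⟨ha, hb⟩
  · rintro e ⟨a, p⟩ ⟨ha, hp⟩ ⟨b, q⟩ ⟨hb, hq⟩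
    have := hD (g e) (x := (g a, p)) ⟨fun h => ha (ginj h), hp⟩ (y := (g b, q))
      ⟨fun h => hb (ginj h), hq⟩
    rw [Prod.mk.injEq] at this
    rw [Prod.mk.injEq]
    exact ⟨ginj this.1, this.2⟩
  · rw [hG, ← Set.image_univ, Set.ncard_image_of_injective _ hf, Set.ncard_univ,
      Nat.card_eq_fintype_card]

/-! ### Gluing two drawings -/

theorem glue_drawings {V1 E1 V2 E2 W : Type} {ends1 : E1 → Sym2 V1} {ends2 : E2 → Sym2 V2}
    (D1 : MultiDrawing V1 E1 ends1) (D2 : MultiDrawing V2 E2 ends2)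
    (h1 : D1.IsOnePlanarD) (h2 : D2.IsOnePlanarD)
    (pos : W → Plane) (hpos : Function.Injective pos)
    (φ1 : V1 → W) (φ2 : V2 → W) (hφ1 : ∀ v, pos (φ1 v) = D1.pos v)
    (hφ2 : ∀ v, pos (φ2 v) = D2.pos v)
    (hav1 : ∀ e w, pos w ∉ D1.inter e) (hav2 : ∀ e w, pos w ∉ D2.inter e)
    (hdis : ∀ e f p, p ∈ D1.inter e → p ∉ D2.inter f) :
    ∃ D : MultiDrawing W (E1 ⊕ E2)
        (Sum.elim (fun e => Sym2.map φ1 (ends1 e)) (fun e => Sym2.map φ2 (ends2 e))),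
      D.IsOnePlanarD ∧ D.pos = pos ∧ (∀ e, D.inter (Sum.inl e) = D1.inter e) ∧
      (∀ e, D.inter (Sum.inr e) = D2.inter e) := by
  have i1 : Function.Injective φ1 := by
    intro a b h
    apply D1.pos_inj
    rw [← hφ1, ← hφ1, h]
  have i2 : Function.Injective φ2 := by
    intro a b h
    apply D2.pos_inj
    rw [← hφ2, ← hφ2, h]
  refine ⟨{ pos := pos
            pos_inj := hpos
            arc := Sum.elim D1.arc D2.arc
            arc_cont := ?_
            arc_inj := ?_
            arc_ends := ?_
            arc_avoid := ?_
            no_incident_cross := ?_ }, ?_, rfl, fun _ => rfl, fun _ => rfl⟩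
  · rintro (e | e)
    · exact D1.arc_cont e
    · exact D2.arc_cont e
  · rintro (e | e)
    · exact D1.arc_inj e
    · exact D2.arc_inj e
  · rintro (e | e)
    · obtain ⟨u, v, a, b, c⟩ := D1.arc_ends e
      exact ⟨φ1 u, φ1 v, by simp [a], by simpa [hφ1] using b, by simpa [hφ1] using c⟩
    · obtain ⟨u, v, a, b, c⟩ := D2.arc_ends e
      exact ⟨φ2 u, φ2 v, by simp [a], by simpa [hφ2] using b, by simpa [hφ2] using c⟩
  · rintro (e | e) w
    · exact hav1 e w
    · exact hav2 e w
  · rintro (e | e) (f | f) hne ⟨p, hp, hq⟩ x ⟨hx, hy⟩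
    · simp only [Sum.elim_inl, Sym2.mem_map] at hx hy
      obtain ⟨a, ha, rfl⟩ := hx
      obtain ⟨b, hb, hab⟩ := hy
      have := i1 hab
      subst this
      exact D1.no_incident_cross e f (fun h => hne (by rw [h])) ⟨p, hp, hq⟩ _ ⟨ha, hb⟩
    · exact hdis e f p hp hq
    · exact hdis f e p hq hp
    · simp only [Sum.elim_inr, Sym2.mem_map] at hx hy
      obtain ⟨a, ha, rfl⟩ := hx
      obtain ⟨b, hb, hab⟩ := hy
      have := i2 hab
      subst this
      exact D2.no_incident_cross e f (fun h => hne (by rw [h])) ⟨p, hp, hq⟩ _ ⟨ha, hb⟩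
  · rintro (e | e) ⟨(a | a), p⟩ ⟨ha, hp⟩ ⟨(b | b), q⟩ ⟨hb, hq⟩
    · have := h1 e (x := (a, p)) ⟨fun h => ha (congrArg Sum.inl h), hp⟩ (y := (b, q))
        ⟨fun h => hb (congrArg Sum.inl h), hq⟩
      rw [Prod.mk.injEq] at this ⊢
      exact ⟨by rw [this.1], this.2⟩
    · exact (hdis e b q hq.1 hq.2).elim
    · exact (hdis e a p hp.1 hp.2).elim
    · exact (hdis e a p hp.1 hp.2).elim
    · exact (hdis a e p hp.2 hp.1).elim
    · exact (hdis a e p hp.2 hp.1).elim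
    · exact (hdis b e q hq.2 hq.1).elim
    · have := h2 e (x := (a, p)) ⟨fun h => ha (congrArg Sum.inr h), hp⟩ (y := (b, q))
        ⟨fun h => hb (congrArg Sum.inr h), hq⟩
      rw [Prod.mk.injEq] at this ⊢
      exact ⟨by rw [this.1], this.2⟩

/-! ### Straight-line drawings with integer coordinates -/

/-- Orientation determinant. -/
def ori (a b p : ℤ × ℤ) : ℤ := (b.1 - a.1) * (p.2 - a.2) - (b.2 - a.2) * (p.1 - a.1)

/-- The segment `cd` is weakly on one side of the line `ab`, and not inside it. -/
def SepL (a b c d : ℤ × ℤ) : Prop :=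
  (0 ≤ ori a b c ∧ 0 ≤ ori a b d ∧ 0 < ori a b c + ori a b d) ∨
  (ori a b c ≤ 0 ∧ ori a b d ≤ 0 ∧ ori a b c + ori a b d < 0)

/-- Segments separated by their first coordinates. -/
def SepX (a b c d : ℤ × ℤ) : Prop :=
  a.1 ≤ c.1 ∧ a.1 ≤ d.1 ∧ b.1 ≤ c.1 ∧ b.1 ≤ d.1 ∧ a.1 ≠ b.1

/-- Two open segments are separated. -/
def SegSep (a b c d : ℤ × ℤ) : Prop :=
  SepL a b c d ∨ SepL c d a b ∨ SepX a b c d ∨ SepX c d a b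

instance (a b c d : ℤ × ℤ) : Decidable (SepL a b c d) := by unfold SepL; infer_instance
instance (a b c d : ℤ × ℤ) : Decidable (SepX a b c d) := by unfold SepX; infer_instance
instance (a b c d : ℤ × ℤ) : Decidable (SegSep a b c d) := by unfold SegSep; infer_instance

/-- The scaled straight segment. -/
def seg (s : ℝ) (a b : ℤ × ℤ) (t : ℝ) : Plane :=
  (s * ((a.1 : ℝ) + t * ((b.1 : ℝ) - a.1)), s * ((a.2 : ℝ) + t * ((b.2 : ℝ) - a.2)))

theorem sepL_disj {s : ℝ} (hs : 0 < s) {a b c d : ℤ × ℤ} (h : SepL a b c d) {t u : ℝ}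
    (hu : u ∈ Ioo (0:ℝ) 1) : seg s a b t ≠ seg s c d u := by
  intro heq
  simp only [seg, Prod.mk.injEq, mul_right_inj' hs.ne'] at heq
  obtain ⟨e1, e2⟩ := heq
  obtain ⟨hu0, hu1⟩ := hu
  have key : (1 - u) * (ori a b c : ℝ) + u * (ori a b d : ℝ) = 0 := by
    simp only [ori]
    push_cast
    linear_combination ((b.2 : ℝ) - a.2) * e1 - ((b.1 : ℝ) - a.1) * e2
  have h1 : 0 < 1 - u := by linarith
  rcases h with ⟨x, y, z⟩ | ⟨x, y, z⟩
  · have x' : (0:ℝ) ≤ ori a b c := by exact_mod_cast x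
    have y' : (0:ℝ) ≤ ori a b d := by exact_mod_cast y
    have z' : (0:ℝ) < ori a b c + ori a b d := by exact_mod_cast z
    rcases x'.lt_or_eq with hx | hx
    · have := mul_pos h1 hx
      have := mul_nonneg hu0.le y'
      linarith
    · have hy : (0:ℝ) < ori a b d := by linarith
      have := mul_nonneg h1.le x'
      have := mul_pos hu0 hy
      linarith
  · have x' : (0:ℝ) ≤ -ori a b c := by exact_mod_cast neg_nonneg.2 x
    have y' : (0:ℝ) ≤ -ori a b d := by exact_mod_cast neg_nonneg.2 y
    have z' : (ori a b c + ori a b d : ℝ) < 0 := by exact_mod_cast z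
    rcases x'.lt_or_eq with hx | hx
    · have := mul_pos h1 hx
      have := mul_nonneg hu0.le y'
      linarith
    · have hy : (0:ℝ) < -ori a b d := by linarith
      have := mul_nonneg h1.le x'
      have := mul_pos hu0 hy
      linarith

theorem sepX_disj {s : ℝ} (hs : 0 < s) {a b c d : ℤ × ℤ} (h : SepX a b c d) {t u : ℝ}
    (ht : t ∈ Ioo (0:ℝ) 1) (hu : u ∈ Ioo (0:ℝ) 1) : seg s a b t ≠ seg s c d u := by
  intro heq
  simp only [seg, Prod.mk.injEq, mul_right_inj' hs.ne'] at heq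
  obtain ⟨e1, -⟩ := heq
  obtain ⟨ht0, ht1⟩ := ht
  obtain ⟨hu0, hu1⟩ := hu
  obtain ⟨h1, h2, h3, h4, h5⟩ := h
  have g1 : (a.1 : ℝ) ≤ c.1 := by exact_mod_cast h1
  have g2 : (a.1 : ℝ) ≤ d.1 := by exact_mod_cast h2
  have g3 : (b.1 : ℝ) ≤ c.1 := by exact_mod_cast h3
  have g4 : (b.1 : ℝ) ≤ d.1 := by exact_mod_cast h4
  have k1 := mul_nonneg (sub_nonneg.2 hu1.le) (sub_nonneg.2 g1)
  have k2 := mul_nonneg hu0.le (sub_nonneg.2 g2)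
  have k3 := mul_nonneg (sub_nonneg.2 hu1.le) (sub_nonneg.2 g3)
  have k4 := mul_nonneg hu0.le (sub_nonneg.2 g4)
  rcases lt_or_gt_of_ne h5 with h | h
  · have g : (a.1 : ℝ) < b.1 := by exact_mod_cast h
    have := mul_pos (sub_pos.2 ht1) (sub_pos.2 g)
    nlinarith
  · have g : (b.1 : ℝ) < a.1 := by exact_mod_cast h
    have := mul_pos ht0 (sub_pos.2 g)
    nlinarith

theorem sep_disj {s : ℝ} (hs : 0 < s) {a b c d : ℤ × ℤ} (h : SegSep a b c d) {t u : ℝ}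
    (ht : t ∈ Ioo (0:ℝ) 1) (hu : u ∈ Ioo (0:ℝ) 1) : seg s a b t ≠ seg s c d u := by
  rcases h with h | h | h | h
  · exact sepL_disj hs h hu
  · exact (sepL_disj hs h ht).symm
  · exact sepX_disj hs h ht hu
  · exact (sepX_disj hs h hu ht).symm

theorem seg_unique {s : ℝ} (hs : 0 < s) {a b c d : ℤ × ℤ}
    (h : (b.1 - a.1) * (d.2 - c.2) - (b.2 - a.2) * (d.1 - c.1) ≠ 0) {t u t' u' : ℝ}
    (h1 : seg s a b t = seg s c d u) (h2 : seg s a b t' = seg s c d u') : t = t' := by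
  simp only [seg, Prod.mk.injEq, mul_right_inj' hs.ne'] at h1 h2
  have h' : ((b.1 : ℝ) - a.1) * (d.2 - c.2) - (b.2 - a.2) * (d.1 - c.1) ≠ 0 := by
    exact_mod_cast h
  apply mul_right_cancel₀ h'
  linear_combination ((d.2 : ℝ) - c.2) * (h1.1 - h2.1) - ((d.1 : ℝ) - c.1) * (h1.2 - h2.2)

/-- The combinatorial conditions for a straight-line 1-planar drawing. -/
structure GoodCfg {V E : Type} (P : V → ℤ × ℤ) (a b : E → V) (partner : E → E) : Prop where
  inj : ∀ v w, P v = P w → v = w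
  ne : ∀ e, a e ≠ b e
  avoid : ∀ e w, ori (P (a e)) (P (b e)) (P w) ≠ 0 ∨
    0 ≤ ((P w).1 - (P (a e)).1) * ((P w).1 - (P (b e)).1) +
        ((P w).2 - (P (a e)).2) * ((P w).2 - (P (b e)).2)
  cross : ∀ e f, e ≠ f → SegSep (P (a e)) (P (b e)) (P (a f)) (P (b f)) ∨
    (partner e = f ∧ (a e ≠ a f ∧ a e ≠ b f ∧ b e ≠ a f ∧ b e ≠ b f) ∧
      ((P (b e)).1 - (P (a e)).1) * ((P (b f)).2 - (P (a f)).2) -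
      ((P (b e)).2 - (P (a e)).2) * ((P (b f)).1 - (P (a f)).1) ≠ 0)
  simple : ∀ e f, (a e = a f ∧ b e = b f) ∨ (a e = b f ∧ b e = a f) → e = f

theorem GoodCfg.ends_inj {V E : Type} {P : V → ℤ × ℤ} {a b : E → V} {partner : E → E}
    (h : GoodCfg P a b partner) : Function.Injective (fun e => s(a e, b e)) := by
  intro e f hef
  apply h.simple
  simpa using hef

theorem GoodCfg.ends_diag {V E : Type} {P : V → ℤ × ℤ} {a b : E → V} {partner : E → E}
    (h : GoodCfg P a b partner) (e : E) : ¬ (s(a e, b e)).IsDiag := by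
  simpa using h.ne e

theorem GoodCfg.drawing {V E : Type} {P : V → ℤ × ℤ} {a b : E → V} {partner : E → E}
    (h : GoodCfg P a b partner) {s : ℝ} (hs : 0 < s) :
    ∃ D : MultiDrawing V E (fun e => s(a e, b e)), D.IsOnePlanarD ∧
      (∀ v, D.pos v = (s * ((P v).1 : ℝ), s * ((P v).2 : ℝ))) ∧
      (∀ e, D.inter e = seg s (P (a e)) (P (b e)) '' Ioo (0:ℝ) 1) := by
  refine ⟨{ pos := fun v => (s * ((P v).1 : ℝ), s * ((P v).2 : ℝ))
            pos_inj := ?_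
            arc := fun e => seg s (P (a e)) (P (b e))
            arc_cont := ?_
            arc_inj := ?_
            arc_ends := ?_
            arc_avoid := ?_
            no_incident_cross := ?_ }, ?_, fun _ => rfl, fun _ => rfl⟩
  · intro v w hvw
    simp only [Prod.mk.injEq, mul_right_inj' hs.ne', Int.cast_inj] at hvw
    exact h.inj v w (Prod.ext hvw.1 hvw.2)
  · intro e
    apply Continuous.continuousOn
    unfold seg
    fun_prop
  · intro e t _ t' _ heq
    simp only [seg, Prod.mk.injEq, mul_right_inj' hs.ne', add_right_inj] at heq
    by_contra hne
    have q1 : ((P (b e)).1 : ℝ) - (P (a e)).1 = 0 := by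
      by_contra hz
      exact hne (mul_right_cancel₀ hz heq.1)
    have q2 : ((P (b e)).2 : ℝ) - (P (a e)).2 = 0 := by
      by_contra hz
      exact hne (mul_right_cancel₀ hz heq.2)
    apply h.ne e
    apply h.inj
    apply Prod.ext
    · exact_mod_cast (sub_eq_zero.1 q1).symm
    · exact_mod_cast (sub_eq_zero.1 q2).symm
  · intro e
    exact ⟨a e, b e, rfl, by simp [seg], by simp [seg]⟩
  · rintro e w ⟨t, ⟨ht0, ht1⟩, ht⟩
    simp only [seg, Prod.mk.injEq, mul_right_inj' hs.ne'] at ht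
    obtain ⟨e1, e2⟩ := ht
    rcases h.avoid e w with h1 | h1
    · apply h1
      have : (ori (P (a e)) (P (b e)) (P w) : ℝ) = 0 := by
        simp only [ori]
        push_cast
        rw [← e1, ← e2]
        ring
      exact_mod_cast this
    · have h2 : (0:ℝ) ≤ (((P w).1 : ℝ) - (P (a e)).1) * ((P w).1 - (P (b e)).1) +
        ((P w).2 - (P (a e)).2) * ((P w).2 - (P (b e)).2) := by exact_mod_cast h1
      rw [← e1, ← e2] at h2
      have h3 : 0 ≤ -(t * (1 - t)) * ((((P (b e)).1 : ℝ) - (P (a e)).1) ^ 2 +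
          (((P (b e)).2 : ℝ) - (P (a e)).2) ^ 2) := by
        refine h2.trans_eq ?_
        ring
      have h4 : 0 < t * (1 - t) := mul_pos ht0 (by linarith)
      have h5 : (((P (b e)).1 : ℝ) - (P (a e)).1) ^ 2 +
          (((P (b e)).2 : ℝ) - (P (a e)).2) ^ 2 ≤ 0 := by
        by_contra hc
        have := mul_pos h4 (not_le.1 hc)
        linarith
      have q1 : ((P (b e)).1 : ℝ) - (P (a e)).1 = 0 := by nlinarith
      have q2 : ((P (b e)).2 : ℝ) - (P (a e)).2 = 0 := by nlinarith
      apply h.ne e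
      apply h.inj
      apply Prod.ext
      · exact_mod_cast (sub_eq_zero.1 q1).symm
      · exact_mod_cast (sub_eq_zero.1 q2).symm
  · rintro e f hne ⟨p, ⟨t, ht, rfl⟩, ⟨u, hu, hp⟩⟩ x ⟨hx, hy⟩
    rcases h.cross e f hne with h1 | ⟨-, ⟨h1, h2, h3, h4⟩, -⟩
    · exact sep_disj hs h1 ht hu hp.symm
    · simp only [Sym2.mem_iff] at hx hy
      rcases hx with rfl | rfl <;> rcases hy with hy | hy <;> contradiction
  · rintro e ⟨f, p⟩ ⟨hf, ⟨t, ht, htp⟩, ⟨u, hu, hup⟩⟩ ⟨g, q⟩ ⟨hg, ⟨t', ht', htp'⟩, ⟨u', hu', hup'⟩⟩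
    dsimp only at *
    rcases h.cross e f hf.symm with h1 | ⟨h1, -, hn⟩
    · exact (sep_disj hs h1 ht hu (htp.trans hup.symm)).elim
    rcases h.cross e g hg.symm with h2 | ⟨h2, -, -⟩
    · exact (sep_disj hs h2 ht' hu' (htp'.trans hup'.symm)).elim
    have hfg : f = g := h1.symm.trans h2
    subst hfg
    have := seg_unique hs hn (htp.trans hup.symm) (htp'.trans hup'.symm)
    rw [← htp, ← htp', this]

/-! ### The inductive family -/

/-- Corners of the standard square. -/
def cor : Fin 4 → ℤ × ℤ := ![(1, 1), (-1, 1), (-1, -1), (1, -1)]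

/-- The closed box of radius `R`. -/
def box (R : ℝ) : Set Plane := {p | -R ≤ p.1 ∧ p.1 ≤ R ∧ -R ≤ p.2 ∧ p.2 ≤ R}

/-- There is a 1-planar drawing of an almost optimal graph with `n` vertices in a box, the four
corners of the box being vertices, opposite corners being non-adjacent. -/
def St (n : ℕ) : Prop :=
  ∃ (V E : Type) (_ : Fintype V) (_ : Fintype E) (ends : E → Sym2 V)
    (D : MultiDrawing V E ends) (c : Fin 4 → V) (R : ℝ),
    0 < R ∧ Fintype.card V = n ∧ Fintype.card E + 10 = 4 * n ∧ Function.Injective ends ∧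
    (∀ e, ¬ (ends e).IsDiag) ∧ D.IsOnePlanarD ∧ (∀ v, D.pos v ∈ box R) ∧
    (∀ e, D.inter e ⊆ box R) ∧
    (∀ i, D.pos (c i) = (R * ((cor i).1 : ℝ), R * ((cor i).2 : ℝ))) ∧
    (∀ e, ends e ≠ s(c 0, c 2)) ∧ (∀ e, ends e ≠ s(c 1, c 3))

/-- Integer box condition. -/
def InBox (L : ℤ) (p : ℤ × ℤ) : Prop := -L ≤ p.1 ∧ p.1 ≤ L ∧ -L ≤ p.2 ∧ p.2 ≤ L

instance (L : ℤ) (p : ℤ × ℤ) : Decidable (InBox L p) := by unfold InBox; infer_instance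

theorem conv_le {x y L t : ℝ} (hx : x ≤ L) (hy : y ≤ L) (h0 : 0 ≤ t) (h1 : t ≤ 1) :
    x + t * (y - x) ≤ L := by
  nlinarith [mul_nonneg h0 (sub_nonneg.2 hy), mul_nonneg (sub_nonneg.2 h1) (sub_nonneg.2 hx)]

theorem le_conv {x y L t : ℝ} (hx : L ≤ x) (hy : L ≤ y) (h0 : 0 ≤ t) (h1 : t ≤ 1) :
    L ≤ x + t * (y - x) := by
  nlinarith [mul_nonneg h0 (sub_nonneg.2 hy), mul_nonneg (sub_nonneg.2 h1) (sub_nonneg.2 hx)]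

theorem inBox_pt {s : ℝ} (hs : 0 < s) {L : ℤ} {p : ℤ × ℤ} (h : InBox L p) :
    ((s * (p.1 : ℝ), s * (p.2 : ℝ)) : Plane) ∈ box (s * L) := by
  obtain ⟨h1, h2, h3, h4⟩ := h
  have g1 : -(L : ℝ) ≤ p.1 := by exact_mod_cast h1
  have g2 : (p.1 : ℝ) ≤ L := by exact_mod_cast h2
  have g3 : -(L : ℝ) ≤ p.2 := by exact_mod_cast h3
  have g4 : (p.2 : ℝ) ≤ L := by exact_mod_cast h4
  refine ⟨?_, ?_, ?_, ?_⟩ <;> dsimp only <;> nlinarith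

theorem inBox_seg {s : ℝ} (hs : 0 < s) {L : ℤ} {p q : ℤ × ℤ} (h : InBox L p) (h' : InBox L q) :
    seg s p q '' Ioo (0:ℝ) 1 ⊆ box (s * L) := by
  rintro _ ⟨t, ⟨ht0, ht1⟩, rfl⟩
  obtain ⟨h1, h2, h3, h4⟩ := h
  obtain ⟨k1, k2, k3, k4⟩ := h'
  have g1 : -(L : ℝ) ≤ p.1 := by exact_mod_cast h1
  have g2 : (p.1 : ℝ) ≤ L := by exact_mod_cast h2
  have g3 : -(L : ℝ) ≤ p.2 := by exact_mod_cast h3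
  have g4 : (p.2 : ℝ) ≤ L := by exact_mod_cast h4
  have l1 : -(L : ℝ) ≤ q.1 := by exact_mod_cast k1
  have l2 : (q.1 : ℝ) ≤ L := by exact_mod_cast k2
  have l3 : -(L : ℝ) ≤ q.2 := by exact_mod_cast k3
  have l4 : (q.2 : ℝ) ≤ L := by exact_mod_cast k4
  refine ⟨?_, ?_, ?_, ?_⟩ <;> dsimp only [seg]
  · rw [← mul_neg]
    exact mul_le_mul_of_nonneg_left (le_conv g1 l1 ht0.le ht1.le) hs.le
  · exact mul_le_mul_of_nonneg_left (conv_le g2 l2 ht0.le ht1.le) hs.le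
  · rw [← mul_neg]
    exact mul_le_mul_of_nonneg_left (le_conv g3 l3 ht0.le ht1.le) hs.le
  · exact mul_le_mul_of_nonneg_left (conv_le g4 l4 ht0.le ht1.le) hs.le

theorem St_of_cfg {n m : ℕ} {P : Fin n → ℤ × ℤ} {a b : Fin m → Fin n} {partner : Fin m → Fin m}
    (h : GoodCfg P a b partner) (hm : m + 10 = 4 * n) (L : ℤ) (hL : 0 < L)
    (hbox : ∀ v, InBox L (P v)) (c : Fin 4 → Fin n)
    (hc : ∀ i, P (c i) = (L * (cor i).1, L * (cor i).2))
    (h02 : ∀ e, s(a e, b e) ≠ s(c 0, c 2)) (h13 : ∀ e, s(a e, b e) ≠ s(c 1, c 3)) : St n := by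
  obtain ⟨D, hD, hp, hi⟩ := h.drawing one_pos
  have hL' : (0:ℝ) < L := by exact_mod_cast hL
  refine ⟨Fin n, Fin m, inferInstance, inferInstance, _, D, c, L, hL', by simp, by simpa using hm,
    h.ends_inj, h.ends_diag, hD, ?_, ?_, ?_, h02, h13⟩
  · intro v
    rw [hp]
    simpa using inBox_pt one_pos (hbox v)
  · intro e
    rw [hi]
    simpa using inBox_seg one_pos (hbox (a e)) (hbox (b e))
  · intro i
    rw [hp, hc]
    simp

/-! ### Base cases -/

theorem St_eight : St 8 := by
  refine St_of_cfg (n := 8) (m := 22)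
    (P := ![(3, 3), (-3, 3), (-3, -3), (3, -3), (2, -1), (2, 1), (-1, 1), (-1, 0)])
    (a := ![0, 0, 0, 1, 1, 2, 2, 3, 4, 4, 5, 6, 0, 3, 0, 1, 1, 2, 5, 4, 3, 2])
    (b := ![1, 3, 5, 2, 6, 3, 7, 4, 5, 7, 6, 7, 4, 5, 6, 5, 7, 6, 7, 6, 7, 4])
    (partner := ![0, 1, 2, 3, 4, 5, 6, 7, 8, 9, 10, 11, 13, 12, 15, 14, 17, 16, 19, 18, 21, 20])
    ⟨?_, ?_, ?_, ?_, ?_⟩ (by norm_num) 3 (by norm_num) ?_ ![0, 1, 2, 3] ?_ ?_ ?_ <;>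
    decide +kernel

theorem St_ten : St 10 := by
  refine St_of_cfg (n := 10) (m := 30)
    (P := ![(3, 3), (-3, 3), (-3, -3), (3, -3), (-1, 2), (0, 0), (1, 0), (-2, -1), (1, 2), (0, -1)])
    (a := ![0, 0, 0, 1, 1, 2, 2, 3, 3, 4, 4, 4, 5, 5, 6, 7, 1, 0, 5, 4, 3, 0, 2, 3, 6, 3, 4, 5,
      1, 2])
    (b := ![1, 3, 8, 2, 4, 3, 7, 6, 9, 5, 7, 8, 6, 9, 8, 9, 8, 4, 8, 6, 8, 6, 9, 7, 9, 5, 9, 7,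
      7, 4])
    (partner := ![0, 1, 2, 3, 4, 5, 6, 7, 8, 9, 10, 11, 12, 13, 14, 15, 17, 16, 19, 18, 21, 20,
      23, 22, 25, 24, 27, 26, 29, 28])
    ⟨?_, ?_, ?_, ?_, ?_⟩ (by norm_num) 3 (by norm_num) ?_ ![0, 1, 2, 3] ?_ ?_ ?_ <;>
    decide +kernel

theorem St_eleven : St 11 := by
  refine St_of_cfg (n := 11) (m := 34)
    (P := ![(4, 4), (-4, 4), (-4, -4), (4, -4), (1, 3), (-3, 2), (-2, 1), (2, 0), (-3, -1),
      (-2, 3), (-1, -1)])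
    (a := ![0, 0, 0, 1, 1, 1, 2, 2, 3, 3, 4, 4, 5, 5, 6, 6, 6, 8, 0, 1, 5, 1, 7, 4, 2, 3, 7, 3,
      5, 6, 3, 0, 1, 2])
    (b := ![1, 3, 4, 2, 5, 9, 3, 8, 7, 10, 7, 9, 6, 8, 7, 9, 10, 10, 9, 4, 9, 6, 9, 6, 10, 8, 10,
      6, 10, 8, 4, 7, 8, 5])
    (partner := ![0, 1, 2, 3, 4, 5, 6, 7, 8, 9, 10, 11, 12, 13, 14, 15, 16, 17, 19, 18, 21, 20,
      23, 22, 25, 24, 27, 26, 29, 28, 31, 30, 33, 32])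
    ⟨?_, ?_, ?_, ?_, ?_⟩ (by norm_num) 4 (by norm_num) ?_ ![0, 1, 2, 3] ?_ ?_ ?_ <;>
    decide +kernel

theorem St_thirteen : St 13 := by
  refine St_of_cfg (n := 13) (m := 42)
    (P := ![(6, 6), (-6, 6), (-6, -6), (6, -6), (-1, 2), (0, 0), (3, -2), (-3, -4), (-1, -3),
      (1, -3), (2, -5), (3, 2), (-2, -5)])
    (a := ![0, 0, 0, 1, 1, 2, 2, 2, 3, 3, 4, 4, 4, 5, 5, 6, 6, 7, 8, 8, 9, 10, 1, 0, 5, 4, 3, 0,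
      9, 8, 7, 2, 3, 2, 1, 2, 4, 5, 5, 6, 6, 3])
    (b := ![1, 3, 11, 2, 4, 3, 7, 12, 6, 10, 5, 7, 11, 6, 8, 9, 11, 8, 9, 12, 10, 12, 11, 4, 11,
      6, 11, 6, 12, 10, 12, 8, 12, 10, 7, 4, 8, 7, 9, 8, 10, 9])
    (partner := ![0, 1, 2, 3, 4, 5, 6, 7, 8, 9, 10, 11, 12, 13, 14, 15, 16, 17, 18, 19, 20, 21,
      23, 22, 25, 24, 27, 26, 29, 28, 31, 30, 33, 32, 35, 34, 37, 36, 39, 38, 41, 40])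
    ⟨?_, ?_, ?_, ?_, ?_⟩ (by norm_num) 6 (by norm_num) ?_ ![0, 1, 2, 3] ?_ ?_ ?_ <;>
    decide +kernel

/-! ### Adding a ring of four vertices -/

/-- Ring vertices: `inl` are the corners of the inner square, `inr` those of the outer one. -/
def ringP : Fin 4 ⊕ Fin 4 → ℤ × ℤ :=
  Sum.elim cor (fun i => (3 * (cor i).1, 3 * (cor i).2))

/-- First end of a ring edge. -/
def ringA : Fin 4 × Fin 4 → Fin 4 ⊕ Fin 4 := fun e =>
  if e.1 = 3 then Sum.inr (e.2 + 1) else Sum.inr e.2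

/-- Second end of a ring edge. -/
def ringB : Fin 4 × Fin 4 → Fin 4 ⊕ Fin 4 := fun e =>
  (![Sum.inr (e.2 + 1), Sum.inl e.2, Sum.inl (e.2 + 1), Sum.inl e.2] : Fin 4 → Fin 4 ⊕ Fin 4) e.1

/-- The edge crossing a ring edge. -/
def ringC : Fin 4 × Fin 4 → Fin 4 × Fin 4 := fun e =>
  ((![0, 1, 3, 2] : Fin 4 → Fin 4) e.1, e.2)

theorem ring_good : GoodCfg ringP ringA ringB ringC := by
  refine ⟨?_, ?_, ?_, ?_, ?_⟩ <;> decide +kernel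

/-- A segment lying outside of the unit box. -/
def OutBox (p q : ℤ × ℤ) : Prop :=
  (1 ≤ p.1 ∧ 1 ≤ q.1 ∧ 2 < p.1 + q.1) ∨ (p.1 ≤ -1 ∧ q.1 ≤ -1 ∧ p.1 + q.1 < -2) ∨
  (1 ≤ p.2 ∧ 1 ≤ q.2 ∧ 2 < p.2 + q.2) ∨ (p.2 ≤ -1 ∧ q.2 ≤ -1 ∧ p.2 + q.2 < -2)

instance (p q : ℤ × ℤ) : Decidable (OutBox p q) := by unfold OutBox; infer_instance

theorem conv_gt {x y : ℤ} (hx : 1 ≤ x) (hy : 1 ≤ y) (hxy : 2 < x + y) {t : ℝ} (h0 : 0 < t)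
    (h1 : t < 1) : 1 < (x : ℝ) + t * (y - x) := by
  have gx : (1:ℝ) ≤ x := by exact_mod_cast hx
  have gy : (1:ℝ) ≤ y := by exact_mod_cast hy
  have gxy : (2:ℝ) < x + y := by exact_mod_cast hxy
  rcases gx.lt_or_eq with h | h
  · nlinarith [mul_pos (sub_pos.2 h1) (sub_pos.2 h), mul_nonneg h0.le (sub_nonneg.2 gy)]
  · have : (1:ℝ) < y := by linarith
    nlinarith [mul_pos h0 (sub_pos.2 this)]

theorem conv_lt {x y : ℤ} (hx : x ≤ -1) (hy : y ≤ -1) (hxy : x + y < -2) {t : ℝ} (h0 : 0 < t)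
    (h1 : t < 1) : (x : ℝ) + t * (y - x) < -1 := by
  have := conv_gt (x := -x) (y := -y) (by omega) (by omega) (by omega) h0 h1
  push_cast at this
  linarith

theorem outBox_seg {s : ℝ} (hs : 0 < s) {p q : ℤ × ℤ} (h : OutBox p q) {z : Plane}
    (hz : z ∈ seg s p q '' Ioo (0:ℝ) 1) : z ∉ box s := by
  obtain ⟨t, ⟨h0, h1⟩, rfl⟩ := hz
  rintro ⟨b1, b2, b3, b4⟩
  dsimp only [seg] at b1 b2 b3 b4
  rcases h with ⟨x, y, w⟩ | ⟨x, y, w⟩ | ⟨x, y, w⟩ | ⟨x, y, w⟩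
  · nlinarith [mul_pos hs (sub_pos.2 (conv_gt x y w h0 h1))]
  · nlinarith [mul_pos hs (sub_pos.2 (conv_lt x y w h0 h1))]
  · nlinarith [mul_pos hs (sub_pos.2 (conv_gt x y w h0 h1))]
  · nlinarith [mul_pos hs (sub_pos.2 (conv_lt x y w h0 h1))]

theorem ring_out : ∀ e, OutBox (ringP (ringA e)) (ringP (ringB e)) := by decide +kernel

theorem ring_in : ∀ v, InBox 3 (ringP v) := by decide +kernel

theorem ringA_inr (e : Fin 4 × Fin 4) : ∃ i, ringA e = Sum.inr i := by
  unfold ringA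
  split_ifs
  · exact ⟨_, rfl⟩
  · exact ⟨_, rfl⟩

theorem cor_out (i : Fin 4) : 1 < |3 * (cor i).1| := by
  revert i; decide +kernel

theorem no_outer_diag : ∀ e, s(ringA e, ringB e) ≠ s(Sum.inr 0, Sum.inr 2) ∧
    s(ringA e, ringB e) ≠ s(Sum.inr 1, Sum.inr 3) := by decide +kernel

theorem outer_notin {R : ℝ} (hR : 0 < R) (i : Fin 4) :
    ((R * ((ringP (Sum.inr i)).1 : ℝ), R * ((ringP (Sum.inr i)).2 : ℝ)) : Plane) ∉ box R := by
  rintro ⟨b1, b2, -, -⟩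
  have h := cor_out i
  dsimp only [ringP, Sum.elim_inr] at b1 b2
  rw [lt_abs] at h
  rcases h with h | h
  · have h' : (1:ℝ) < ((3 * (cor i).1 : ℤ) : ℝ) := by exact_mod_cast h
    nlinarith
  · have h' : (1:ℝ) < -((3 * (cor i).1 : ℤ) : ℝ) := by exact_mod_cast h
    nlinarith

theorem box_mono {R S : ℝ} (h : R ≤ S) : box R ⊆ box S := by
  rintro p ⟨h1, h2, h3, h4⟩
  exact ⟨by linarith, by linarith, by linarith, by linarith⟩

theorem St_step {n : ℕ} (h : St n) : St (n + 4) := by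
  obtain ⟨V, E, _, _, ends, D, c, R, hR, hV, hE, hinj, hdiag, hD, hpb, hib, hc, -, -⟩ := h
  obtain ⟨D2, hD2, hp2, hi2⟩ := ring_good.drawing hR
  let pos : V ⊕ Fin 4 → Plane := Sum.elim D.pos (fun i => D2.pos (Sum.inr i))
  let φ2 : Fin 4 ⊕ Fin 4 → V ⊕ Fin 4 := Sum.elim (fun i => Sum.inl (c i)) Sum.inr
  have hout : ∀ i, D2.pos (Sum.inr i) ∉ box R := by
    intro i
    rw [hp2]
    exact outer_notin hR i
  have hiout : ∀ e p, p ∈ D2.inter e → p ∉ box R := by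
    intro e p hp
    rw [hi2] at hp
    exact outBox_seg hR (ring_out e) hp
  have hpos : Function.Injective pos := by
    rintro (v | i) (w | j) h
    · exact congrArg _ (D.pos_inj h)
    · exact (hout j (by have := hpb v; rw [show D.pos v = D2.pos (Sum.inr j) from h] at this; exact this)).elim
    · exact (hout i (by have := hpb w; rw [← show D2.pos (Sum.inr i) = D.pos w from h] at this; exact this)).elim
    · have := D2.pos_inj h
      rw [Sum.inr.injEq] at this
      rw [this]
  have hφ2 : ∀ v, pos (φ2 v) = D2.pos v := by
    rintro (i | i)
    · change D.pos (c i) = _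
      rw [hc, hp2]
      rfl
    · rfl
  have hφ2i : Function.Injective φ2 := by
    intro x y hxy
    apply D2.pos_inj
    rw [← hφ2, ← hφ2, hxy]
  obtain ⟨D3, hD3, hp3, hl3, hr3⟩ := glue_drawings D D2 hD hD2 pos hpos Sum.inl φ2
    (fun _ => rfl) hφ2 (by
      rintro e (v | i) h
      · exact D.arc_avoid e v h
      · exact hout i (hib e h)) (by
      rintro e (v | i) h
      · exact hiout e _ h (hpb v)
      · exact D2.arc_avoid e _ h) (fun e f p hp hq => hiout f p hq (hib e hp))
  have hR3 : R ≤ R * (3:ℤ) := by push_cast; linarith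
  refine ⟨V ⊕ Fin 4, E ⊕ (Fin 4 × Fin 4), inferInstance, inferInstance, _, D3, Sum.inr,
    R * (3:ℤ), by push_cast; linarith, by simp [hV], by simp; omega, ?_, ?_, hD3, ?_, ?_, ?_, ?_, ?_⟩
  · have hmix : ∀ e f, Sym2.map Sum.inl (ends e) ≠ Sym2.map φ2 s(ringA f, ringB f) := by
      intro e f h
      obtain ⟨i, hi⟩ := ringA_inr f
      have : (Sum.inr i : V ⊕ Fin 4) ∈ Sym2.map Sum.inl (ends e) := by
        rw [h, Sym2.map_mk, hi]
        exact Sym2.mem_mk_left _ _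
      rw [Sym2.mem_map] at this
      obtain ⟨_, _, h⟩ := this
      cases h
    rintro (e | e) (f | f) h
    · exact congrArg _ (hinj (Sym2.map.injective Sum.inl_injective h))
    · exact (hmix e f h).elim
    · exact (hmix f e h.symm).elim
    · exact congrArg _ (ring_good.ends_inj (Sym2.map.injective hφ2i h))
  · rintro (e | e) h
    · exact hdiag e ((Sym2.isDiag_map Sum.inl_injective).1 h)
    · exact ring_good.ends_diag e ((Sym2.isDiag_map hφ2i).1 h)
  · rw [hp3]
    rintro (v | i)
    · exact box_mono hR3 (hpb v)
    · change D2.pos _ ∈ _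
      rw [hp2]
      exact inBox_pt hR (ring_in _)
  · rintro (e | e)
    · rw [hl3]
      exact (hib e).trans (box_mono hR3)
    · rw [hr3, hi2]
      exact inBox_seg hR (ring_in _) (ring_in _)
  · intro i
    rw [hp3]
    change D2.pos _ = _
    rw [hp2]
    simp [ringP, mul_assoc]
  · rintro (e | e) h
    · have : (Sum.inr 0 : V ⊕ Fin 4) ∈ Sym2.map Sum.inl (ends e) := by
        have h' : Sym2.map Sum.inl (ends e) = _ := h
        rw [h']
        exact Sym2.mem_mk_left _ _
      rw [Sym2.mem_map] at this
      obtain ⟨_, _, h⟩ := this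
      cases h
    · exact (no_outer_diag e).1 (Sym2.map.injective hφ2i h)
  · rintro (e | e) h
    · have : (Sum.inr 1 : V ⊕ Fin 4) ∈ Sym2.map Sum.inl (ends e) := by
        have h' : Sym2.map Sum.inl (ends e) = _ := h
        rw [h']
        exact Sym2.mem_mk_left _ _
      rw [Sym2.mem_map] at this
      obtain ⟨_, _, h⟩ := this
      cases h
    · exact (no_outer_diag e).2 (Sym2.map.injective hφ2i h)

/-! ### The two outer diagonals -/

/-- The outer arc from corner 0 to corner 2 (`b = false`) or from 1 to 3 (`b = true`). -/
def outArc (R : ℝ) (b : Bool) (t : ℝ) : Plane :=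
  if b then (R * (-(1 - 2 * t) + 8 * t * (1 - t)), R * (1 - 2 * t + 8 * t * (1 - t)))
  else (R * (1 - 2 * t - 8 * t * (1 - t)), R * (1 - 2 * t + 8 * t * (1 - t)))

theorem outArc_out {R : ℝ} (hR : 0 < R) (b : Bool) {t : ℝ} (ht : t ∈ Ioo (0:ℝ) 1) :
    outArc R b t ∉ box R := by
  obtain ⟨h0, h1⟩ := ht
  rintro ⟨b1, b2, b3, b4⟩
  have hp : 0 < t * (1 - t) := mul_pos h0 (by linarith)
  have key : ∀ x, R * x ≤ R → x ≤ 1 := fun x hx => by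
    by_contra hc
    nlinarith [mul_pos hR (sub_pos.2 (not_le.1 hc))]
  have key' : ∀ x, -R ≤ R * x → -1 ≤ x := fun x hx => by
    have := key (-x) (by linarith)
    linarith
  cases b
  · simp only [outArc, Bool.false_eq_true, if_false] at b1 b2 b3 b4
    have c1 := key' _ b1
    have c4 := key _ b4
    nlinarith [mul_nonneg h0.le h0.le]
  · simp only [outArc, if_true] at b1 b2 b3 b4
    have c1 := key _ b2
    have c4 := key _ b4
    nlinarith [mul_nonneg h0.le h0.le]

theorem outArc_cross {R : ℝ} (hR : 0 < R) {t u t' u' : ℝ} (ht : t ∈ Ioo (0:ℝ) 1)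
    (hu : u ∈ Ioo (0:ℝ) 1) (ht' : t' ∈ Ioo (0:ℝ) 1) (hu' : u' ∈ Ioo (0:ℝ) 1)
    (h : outArc R false t = outArc R true u) (h' : outArc R false t' = outArc R true u') :
    t = t' ∧ u = u' := by
  have main : ∀ t u : ℝ, t ∈ Ioo (0:ℝ) 1 → u ∈ Ioo (0:ℝ) 1 →
      outArc R false t = outArc R true u → t = u ∧ 1 - 2 * t = 4 * t * (1 - t) * 2 := by
    intro t u ht hu h
    simp only [outArc, Bool.false_eq_true, if_false, if_true, Prod.mk.injEq,
      mul_right_inj' hR.ne'] at h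
    obtain ⟨e1, e2⟩ := h
    obtain ⟨h0, h1⟩ := ht
    obtain ⟨k0, k1⟩ := hu
    have f1 : 1 - 2 * t = 8 * u * (1 - u) := by linarith
    have f2 : 1 - 2 * u = 8 * t * (1 - t) := by linarith
    have p1 : 0 < u * (1 - u) := mul_pos k0 (by linarith)
    have p2 : 0 < t * (1 - t) := mul_pos h0 (by linarith)
    have hfac : (t - u) * (8 * (1 - t - u) - 2) = 0 := by linear_combination f1 - f2
    rcases mul_eq_zero.1 hfac with hz | hz
    · have : t = u := by linarith
      subst this
      exact ⟨rfl, by linarith⟩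
    · exfalso
      have hu : u = 3 / 4 - t := by linarith
      rw [hu] at f1 p1
      nlinarith
  obtain ⟨a1, a2⟩ := main t u ht hu h
  obtain ⟨b1, b2⟩ := main t' u' ht' hu' h'
  have htt : t = t' := by
    have hfac : (t - t') * (10 - 8 * (t + t')) = 0 := by linear_combination -a2 + b2
    rcases mul_eq_zero.1 hfac with hz | hz
    · linarith
    · exfalso
      obtain ⟨h0, h1⟩ := ht
      obtain ⟨k0, k1⟩ := ht'
      have p2 : 0 < t * (1 - t) := mul_pos h0 (by linarith)
      have p2 : 0 < t' * (1 - t') := mul_pos k0 (by linarith)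
      nlinarith
  exact ⟨htt, by rw [← a1, ← b1, htt]⟩

theorem outer_drawing {R : ℝ} (hR : 0 < R) :
    ∃ D : MultiDrawing (Fin 4) Bool (fun b => if b then s(1, 3) else s(0, 2)), D.IsOnePlanarD ∧
      (∀ i, D.pos i = (R * ((cor i).1 : ℝ), R * ((cor i).2 : ℝ))) ∧
      (∀ e p, p ∈ D.inter e → p ∉ box R) := by
  have hcor : ∀ i, InBox 1 (cor i) := by decide +kernel
  have hinj : ∀ i j, cor i = cor j → i = j := by decide +kernel
  refine ⟨{ pos := fun i => (R * ((cor i).1 : ℝ), R * ((cor i).2 : ℝ))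
            pos_inj := ?_
            arc := outArc R
            arc_cont := ?_
            arc_inj := ?_
            arc_ends := ?_
            arc_avoid := ?_
            no_incident_cross := ?_ }, ?_, fun _ => rfl, ?_⟩
  · intro v w hvw
    simp only [Prod.mk.injEq, mul_right_inj' hR.ne', Int.cast_inj] at hvw
    exact hinj v w (Prod.ext hvw.1 hvw.2)
  · intro e
    apply Continuous.continuousOn
    cases e <;> unfold outArc <;> simp only [Bool.false_eq_true, if_false, if_true] <;> fun_prop
  · rintro (_ | _) t _ t' _ h <;>
      simp only [outArc, Bool.false_eq_true, if_false, if_true, Prod.mk.injEq,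
        mul_right_inj' hR.ne'] at h <;> linarith [h.1, h.2]
  · rintro (_ | _)
    · exact ⟨0, 2, rfl, by simp [outArc, cor], by simp [outArc, cor]; norm_num⟩
    · exact ⟨1, 3, rfl, by simp [outArc, cor], by simp [outArc, cor]; norm_num⟩
  · rintro e w ⟨t, ht, hw⟩
    apply outArc_out hR e ht
    rw [hw]
    simpa using inBox_pt hR (hcor w)
  · rintro (_ | _) (_ | _) hne - x ⟨hx, hy⟩
    · exact hne rfl
    · revert hx hy; revert x; decide
    · revert hx hy; revert x; decide
    · exact hne rfl
  · rintro (_ | _) ⟨(_ | _), p⟩ ⟨ha, hp, hp'⟩ ⟨(_ | _), q⟩ ⟨hb, hq, hq'⟩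
    all_goals first | exact absurd rfl ha | exact absurd rfl hb | skip
    · obtain ⟨t, ht, htp⟩ := hp
      obtain ⟨u, hu, hup⟩ := hp'
      obtain ⟨t', ht', htp'⟩ := hq
      obtain ⟨u', hu', hup'⟩ := hq'
      dsimp only at *
      have := outArc_cross hR ht hu ht' hu' (htp.trans hup.symm) (htp'.trans hup'.symm)
      rw [← htp, ← htp', this.1]
    · obtain ⟨t, ht, htp⟩ := hp
      obtain ⟨u, hu, hup⟩ := hp'
      obtain ⟨t', ht', htp'⟩ := hq
      obtain ⟨u', hu', hup'⟩ := hq'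
      dsimp only at *
      have := outArc_cross hR hu ht hu' ht' (hup.trans htp.symm) (hup'.trans htp'.symm)
      rw [← htp, ← htp', this.2]
  · rintro e _ ⟨t, ht, rfl⟩
    exact outArc_out hR e ht

theorem St_finish {n : ℕ} (h : St n) :
    ∃ G : SimpleGraph (Fin n), G.IsOnePlanar ∧ G.edgeSet.ncard = 4 * n - 8 := by
  obtain ⟨V, E, _, _, ends, D, c, R, hR, hV, hE, hinj, hdiag, hD, hpb, hib, hc, h02, h13⟩ := h
  obtain ⟨D2, hD2, hp2, hi2⟩ := outer_drawing hR
  have hφ2 : ∀ v, D.pos (c v) = D2.pos v := by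
    intro v
    rw [hc, hp2]
  have hci : Function.Injective c := by
    intro x y hxy
    apply D2.pos_inj
    rw [← hφ2, ← hφ2, hxy]
  obtain ⟨D3, hD3, -, -, -⟩ := glue_drawings D D2 hD hD2 D.pos D.pos_inj id c
    (fun _ => rfl) hφ2 (fun e w => D.arc_avoid e w) (fun e w h => hi2 e _ h (hpb w))
    (fun e f p hp hq => hi2 f p hq (hib e hp))
  have hmix : ∀ e (f : Bool), Sym2.map id (ends e) ≠
      Sym2.map c ((fun b : Bool => if b then s(1, 3) else s(0, 2)) f) := by
    rintro e (_ | _) h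
    · rw [Sym2.map_id] at h
      exact h02 e h
    · rw [Sym2.map_id] at h
      exact h13 e h
  have hib : Function.Injective (fun b : Bool => (if b then s(1, 3) else s(0, 2) : Sym2 (Fin 4))) := by
    decide
  have hdb : ∀ b : Bool, ¬ (if b then s(1, 3) else s(0, 2) : Sym2 (Fin 4)).IsDiag := by
    decide
  obtain ⟨G, hG, hcard⟩ := finish_graph n hV (by
    rintro (e | e) (f | f) h
    · exact congrArg _ (hinj (Sym2.map.injective Function.injective_id h))
    · exact (hmix e f h).elim
    · exact (hmix f e h.symm).elim
    · exact congrArg _ (hib (Sym2.map.injective hci h))) (by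
    rintro (e | e) h
    · exact hdiag e ((Sym2.isDiag_map Function.injective_id).1 h)
    · exact hdb e ((Sym2.isDiag_map hci).1 h)) D3 hD3
  refine ⟨G, hG, ?_⟩
  rw [hcard]
  simp
  omega

theorem St_all (n : ℕ) (hn : n = 8 ∨ 10 ≤ n) : St n := by
  induction n using Nat.strong_induction_on with
  | _ n ih =>
    by_cases h : n = 8 ∨ n = 10 ∨ n = 11 ∨ n = 13
    · rcases h with rfl | rfl | rfl | rfl
      · exact St_eight
      · exact St_ten
      · exact St_eleven
      · exact St_thirteen
    · have := St_step (ih (n - 4) (by omega) (by omega))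
      rwa [show n - 4 + 4 = n by omega] at this

/-- For `n = 8` and for every `n ≥ 10` there is a 1-planar
graph on `n` vertices with exactly `4n − 8` edges. -/
theorem exists_optimal_one_planar (n : ℕ) (hn : n = 8 ∨ 10 ≤ n) :
    ∃ G : SimpleGraph (Fin n), G.IsOnePlanar ∧ G.edgeSet.ncard = 4 * n - 8 :=
  St_finish (St_all n hn)
end
end
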